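/- For every even integer n ≥ 18, writing n = i + 8(t+1) with t ≥ 1 an integer and 0 < i ≤ 8, the graph G''_n = G'_t⟨S_{i/2}⟩ is an extremal brick; that is, the number of perfect matchings of G''_n equals |E(G''_n)| − |V(G''_n)| + 1. -/

import Mathlib

open SimpleGraph

/-- The number of perfect matchings of a graph. -/
noncomputable def numPM {V : Type*} (G : SimpleGraph V) : ℕ :=
  Set.ncard {M : G.Subgraph | M.IsPerfectMatching}

/-- A graph is 3-connected if it has at least 4 vertices and deleting any set of at most
two vertices leaves a connected graph. -/
def ThreeConnected {V : Type*} [Fintype V] (G : SimpleGraph V) : Prop :=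
  4 ≤ Fintype.card V ∧
    ∀ s : Set V, s.ncard ≤ 2 → (G.induce (sᶜ : Set V)).Connected

/-- A brick: a 3-connected graph such that deleting any two distinct vertices leaves
a graph with a perfect matching (Edmonds–Lovász–Pulleyblank characterization). -/
def IsBrick {V : Type*} [Fintype V] (G : SimpleGraph V) : Prop :=
  ThreeConnected G ∧
    ∀ x y : V, x ≠ y →
      ∃ M : (G.induce {v : V | v ≠ x ∧ v ≠ y}).Subgraph, M.IsPerfectMatching

/-- A brick is extremal when its number of perfect matchings equals |E| - |V| + 1. -/
def IsExtremal {V : Type*} [Fintype V] (G : SimpleGraph V) : Prop :=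
  numPM G + Fintype.card V = G.edgeSet.ncard + 1

/-- The set `S = {u₀¹, u₀³, u} ∪ {uₛ², uₛ⁴ : 0 ≤ s ≤ t}` of vertices of `G_t`
(here `Sum.inl (s, j)` is the vertex `u_s^{j+1}` and `Sum.inr false` is `u`;
`Sum.inr true` will be the extra vertex `u'` of `G'_t`). -/
def Sset (t : ℕ) : Set ((Fin (t + 1) × Fin 4) ⊕ Bool) :=
  {p | p = Sum.inl (0, 0) ∨ p = Sum.inl (0, 2) ∨ p = Sum.inr false ∨
       ∃ s : Fin (t + 1), p = Sum.inl (s, 1) ∨ p = Sum.inl (s, 3)}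

/-- The graph `G'_t`: the vertex `Sum.inl (s, j)` is `u_s^{j+1}`, `Sum.inr false` is `u`
and `Sum.inr true` is `u'`.  The edges are the path edges `u_s^1 u_s^2 u_s^3 u_s^4`
for `0 ≤ s ≤ t`, the edges `u_s^1 u_{s+1}^1` and `u_s^4 u_{s+1}^3` for `0 ≤ s ≤ t−1`,
the edges `u u_t^1` and `u u_t^4`, and the edges from `u'` to every vertex of `S`. -/
def G't (t : ℕ) : SimpleGraph ((Fin (t + 1) × Fin 4) ⊕ Bool) :=
  SimpleGraph.fromRel (fun p q =>
    (∃ (s : Fin (t + 1)) (j j' : Fin 4), (j' : ℕ) = (j : ℕ) + 1 ∧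
        p = Sum.inl (s, j) ∧ q = Sum.inl (s, j')) ∨
    (∃ s s' : Fin (t + 1), (s' : ℕ) = (s : ℕ) + 1 ∧
        ((p = Sum.inl (s, 0) ∧ q = Sum.inl (s', 0)) ∨
         (p = Sum.inl (s, 3) ∧ q = Sum.inl (s', 2)))) ∨
    (p = Sum.inl (Fin.last t, 0) ∧ q = Sum.inr false) ∨
    (p = Sum.inl (Fin.last t, 3) ∧ q = Sum.inr false) ∨
    (p ∈ Sset t ∧ q = Sum.inr true))

/-- The sets `S₁ = S \ {u_t², u_t⁴, u}`, `S₂ = S \ {u_t⁴, u}`, `S₃ = S \ {u}`, `S₄ = S`. -/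
def Ssub (t : ℕ) : ℕ → Set ((Fin (t + 1) × Fin 4) ⊕ Bool)
  | 1 => Sset t \ {Sum.inl (Fin.last t, 1), Sum.inl (Fin.last t, 3), Sum.inr false}
  | 2 => Sset t \ {Sum.inl (Fin.last t, 3), Sum.inr false}
  | 3 => Sset t \ {Sum.inr false}
  | _ => Sset t

/-- Vertices of the graph obtained from `G` by simultaneous triangle-insertions at all
vertices of `S'`: a vertex is either `(v, none)` for an untouched vertex `v ∉ S'`, or
`(v, some w)` for `v ∈ S'` and `w` a neighbor of `v`, the triangle vertex of `v`
facing `w`.  (When every vertex of `S'` has degree 3, each `v ∈ S'` is replaced by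
a triangle whose vertex facing `w` is joined to `w`.) -/
abbrev ExpandVerts {V : Type*} (G : SimpleGraph V) (S' : Set V) : Type _ :=
  {p : V × Option V //
    (p.1 ∉ S' ∧ p.2 = none) ∨ (p.1 ∈ S' ∧ ∃ w, p.2 = some w ∧ G.Adj p.1 w)}

noncomputable instance expandVertsFintype {V : Type*} [Fintype V] (G : SimpleGraph V)
    (S' : Set V) : Fintype (ExpandVerts G S') := by
  classical exact Subtype.fintype _

/-- The graph obtained from `G` by triangle-insertions at all vertices of `S'`:
two untouched vertices are adjacent iff they were adjacent in `G`; the triangle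
vertex of `v` facing `w` is adjacent to the other two triangle vertices of `v`,
and to `w` (to the triangle vertex of `w` facing `v`, if `w ∈ S'`). -/
def expand {V : Type*} (G : SimpleGraph V) (S' : Set V) :
    SimpleGraph (ExpandVerts G S') :=
  SimpleGraph.fromRel (fun p q =>
    (p.1.2 = none ∧ q.1.2 = none ∧ G.Adj p.1.1 q.1.1) ∨
    (p.1.2 = none ∧ q.1.2 = some p.1.1) ∨
    (∃ w w' : V, p.1.2 = some w ∧ q.1.2 = some w' ∧
      ((p.1.1 = q.1.1 ∧ w ≠ w') ∨ (q.1.1 = w ∧ p.1.1 = w'))))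


section ExpandGeneral

variable {V : Type*} {G : SimpleGraph V} {S' : Set V}

open Classical in
/-- The vertex of the expansion at `v` which carries the edge `vw`. -/
noncomputable def liftV (S' : Set V) {v w : V} (h : G.Adj v w) : ExpandVerts G S' :=
  if hv : v ∈ S' then ⟨(v, some w), Or.inr ⟨hv, w, rfl, h⟩⟩ else ⟨(v, none), Or.inl ⟨hv, rfl⟩⟩

lemma liftV_fst {v w : V} (h : G.Adj v w) : (liftV S' h).1.1 = v := by
  unfold liftV; split <;> rfl

lemma liftV_val_mem {v w : V} (h : G.Adj v w) (hv : v ∈ S') : (liftV S' h).1 = (v, some w) := by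
  unfold liftV; rw [dif_pos hv]

lemma liftV_val_not_mem {v w : V} (h : G.Adj v w) (hv : v ∉ S') : (liftV S' h).1 = (v, none) := by
  unfold liftV; rw [dif_neg hv]

lemma eq_liftV_of_some {p : ExpandVerts G S'} {w : V} (hw : p.1.2 = some w) :
    ∃ h : G.Adj p.1.1 w, p = liftV S' h := by
  obtain ⟨⟨v, o⟩, hp⟩ := p
  rcases hp with ⟨h1, h2⟩ | ⟨h1, w', h2, h3⟩
  · exact absurd (hw.symm.trans h2) (by simp)
  · simp only at hw h2 h1 h3
    subst hw
    cases h2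
    exact ⟨h3, Subtype.ext (liftV_val_mem h3 h1).symm⟩

lemma mem_of_some {p : ExpandVerts G S'} {w : V} (hw : p.1.2 = some w) : p.1.1 ∈ S' := by
  rcases p.2 with ⟨h1, h2⟩ | ⟨h1, w', h2, h3⟩
  · rw [h2] at hw; cases hw
  · exact h1

lemma eq_liftV_of_none {p : ExpandVerts G S'} (hw : p.1.2 = none) {w : V} (h : G.Adj p.1.1 w) :
    p = liftV S' h := by
  obtain ⟨⟨v, o⟩, hp⟩ := p
  rcases hp with ⟨h1, h2⟩ | ⟨h1, w', h2, h3⟩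
  · simp only at hw h2 h1 h
    subst hw
    exact Subtype.ext (liftV_val_not_mem h h1).symm
  · exact absurd (h2.symm.trans hw) (by simp)

lemma eq_liftV_of_not_mem {p : ExpandVerts G S'} (hp : p.1.1 ∉ S') {w : V}
    (h : G.Adj p.1.1 w) : p = liftV S' h := by
  refine eq_liftV_of_none ?_ h
  cases hw : p.1.2 with
  | none => rfl
  | some w => exact absurd (mem_of_some hw) hp

lemma exists_liftV_of_mem {p : ExpandVerts G S'} (hp : p.1.1 ∈ S') :
    ∃ w, ∃ h : G.Adj p.1.1 w, p = liftV S' h := by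
  rcases hw : p.1.2 with _ | w
  · rcases p.2 with ⟨h1, h2⟩ | ⟨h1, w', h2, h3⟩
    · exact absurd hp h1
    · rw [hw] at h2; cases h2
  · exact ⟨w, eq_liftV_of_some hw⟩

lemma liftV_inj_mem {v w w' : V} (h : G.Adj v w) (h' : G.Adj v w') (hv : v ∈ S') :
    liftV S' h = liftV S' h' ↔ w = w' := by
  constructor
  · intro e
    have := congrArg Subtype.val e
    rw [liftV_val_mem h hv, liftV_val_mem h' hv] at this
    simpa using this
  · rintro rfl; rfl

lemma eq_of_fst_not_mem {p q : ExpandVerts G S'} (hp : p.1.1 ∉ S') (h : p.1.1 = q.1.1) :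
    p = q := by
  obtain ⟨⟨v, o⟩, h1⟩ := p
  obtain ⟨⟨v', o'⟩, h1'⟩ := q
  simp only at h hp
  subst h
  have e1 : o = none := by
    rcases h1 with h1 | h1
    · exact h1.2
    · exact absurd h1.1 hp
  have e2 : o' = none := by
    rcases h1' with h1 | h1
    · exact h1.2
    · exact absurd h1.1 hp
  subst e1 e2
  rfl

lemma expand_adj {p q : ExpandVerts G S'} :
    (expand G S').Adj p q ↔ (p.1.1 = q.1.1 ∧ p ≠ q) ∨
      ∃ h : G.Adj p.1.1 q.1.1, p = liftV S' h ∧ q = liftV S' h.symm := by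
  have key : ∀ p q : ExpandVerts G S',
      ((p.1.2 = none ∧ q.1.2 = none ∧ G.Adj p.1.1 q.1.1) ∨
      (p.1.2 = none ∧ q.1.2 = some p.1.1) ∨
      (∃ w w' : V, p.1.2 = some w ∧ q.1.2 = some w' ∧
      ((p.1.1 = q.1.1 ∧ w ≠ w') ∨ (q.1.1 = w ∧ p.1.1 = w')))) →
      ((p.1.1 = q.1.1 ∧ p ≠ q) ∨
      ∃ h : G.Adj p.1.1 q.1.1, p = liftV S' h ∧ q = liftV S' h.symm) := by
    intro p q h
    rcases h with ⟨h1, h2, h3⟩ | ⟨h1, h2⟩ | ⟨w, w', h1, h2, ⟨h3, h4⟩ | ⟨h3, h4⟩⟩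
    · exact Or.inr ⟨h3, eq_liftV_of_none h1 _, eq_liftV_of_none h2 _⟩
    · obtain ⟨h, e⟩ := eq_liftV_of_some h2
      exact Or.inr ⟨h.symm, eq_liftV_of_none h1 _, e⟩
    · refine Or.inl ⟨h3, ?_⟩
      rintro rfl
      rw [h1] at h2
      exact h4 (by simpa using h2)
    · subst h3 h4
      obtain ⟨h, e⟩ := eq_liftV_of_some h1
      obtain ⟨h', e'⟩ := eq_liftV_of_some h2
      exact Or.inr ⟨h, e, e'⟩
  constructor
  · intro h
    rw [expand, SimpleGraph.fromRel_adj] at h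
    rcases h.2 with h | h
    · exact key p q h
    · rcases key q p h with ⟨h1, h2⟩ | ⟨h, e1, e2⟩
      · exact Or.inl ⟨h1.symm, h2.symm⟩
      · exact Or.inr ⟨h.symm, e2, e1⟩
  · rw [expand, SimpleGraph.fromRel_adj]
    rintro (⟨h1, h2⟩ | ⟨h, e1, e2⟩)
    · refine ⟨h2, Or.inl (Or.inr (Or.inr ?_))⟩
      have hp : p.1.1 ∈ S' := by
        by_contra hp
        exact h2 (eq_of_fst_not_mem hp h1)
      have hq : q.1.1 ∈ S' := h1 ▸ hp
      rcases p.2 with h3 | ⟨_, w, h3, h4⟩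
      · exact absurd hp h3.1
      rcases q.2 with h3 | ⟨_, w', h3', h4'⟩
      · exact absurd hq h3.1
      refine ⟨w, w', h3, h3', Or.inl ⟨h1, ?_⟩⟩
      rintro rfl
      exact h2 (Subtype.ext (Prod.ext h1 (h3.trans h3'.symm)))
    · refine ⟨fun e => h.ne (by rw [e]), ?_⟩
      by_cases hp : p.1.1 ∈ S' <;> by_cases hq : q.1.1 ∈ S'
      · left; right; right
        refine ⟨q.1.1, p.1.1, ?_, ?_, Or.inr ⟨rfl, rfl⟩⟩
        · have := liftV_val_mem h hp
          rw [← e1] at this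
          exact congrArg Prod.snd this
        · have := liftV_val_mem h.symm hq
          rw [← e2] at this
          exact congrArg Prod.snd this
      · right; right; left
        refine ⟨?_, ?_⟩
        · have := liftV_val_not_mem h.symm hq
          rw [← e2] at this
          exact congrArg Prod.snd this
        · have := liftV_val_mem h hp
          rw [← e1] at this
          exact congrArg Prod.snd this
      · left; right; left
        refine ⟨?_, ?_⟩
        · have := liftV_val_not_mem h hp
          rw [← e1] at this
          exact congrArg Prod.snd this
        · have := liftV_val_mem h.symm hq
          rw [← e2] at this
          exact congrArg Prod.snd this
      · left; left
        refine ⟨?_, ?_, h⟩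
        · have := liftV_val_not_mem h hp
          rw [← e1] at this
          exact congrArg Prod.snd this
        · have := liftV_val_not_mem h.symm hq
          rw [← e2] at this
          exact congrArg Prod.snd this

lemma expand_adj_lift {v w : V} (h : G.Adj v w) :
    (expand G S').Adj (liftV S' h) (liftV S' h.symm) := by
  rw [expand_adj]
  right
  have e1 := liftV_fst (S' := S') h
  have e2 := liftV_fst (S' := S') h.symm
  refine ⟨by rw [e1, e2]; exact h, ?_, ?_⟩ <;> congr 1 <;> simp [e1, e2]

end ExpandGeneral

section ExpandConn

variable {V : Type*} {G : SimpleGraph V} {S' : Set V}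

lemma other_nbr {v : V} (hd : (G.neighborSet v).ncard = 3) {a : V} (ha : G.Adj v a) :
    ∃ b c, G.Adj v b ∧ G.Adj v c ∧ b ≠ a ∧ c ≠ a ∧ b ≠ c ∧
      ∀ w, G.Adj v w → w = a ∨ w = b ∨ w = c := by
  obtain ⟨x, y, z, h1, h2, h3, he⟩ := Set.ncard_eq_three.1 hd
  have key : ∀ w, G.Adj v w ↔ w = x ∨ w = y ∨ w = z := by
    intro w
    rw [← SimpleGraph.mem_neighborSet, he]; simp
  simp only [key] at *
  rcases ha with rfl | rfl | rfl
  · exact ⟨y, z, by grind⟩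
  · exact ⟨x, z, by grind⟩
  · exact ⟨x, y, by grind⟩

lemma third_nbr {v : V} (hd : (G.neighborSet v).ncard = 3) {a b : V} (ha : G.Adj v a)
    (hb : G.Adj v b) (hab : a ≠ b) :
    ∃ c, G.Adj v c ∧ c ≠ a ∧ c ≠ b ∧ ∀ w, G.Adj v w → w = a ∨ w = b ∨ w = c := by
  obtain ⟨x, y, h1, h2, h3, h4, h5, h6⟩ := other_nbr hd ha
  rcases h6 b hb with h | h | h
  · exact absurd h.symm hab
  · subst h
    exact ⟨y, h2, h4, h5.symm, h6⟩
  · subst h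
    exact ⟨x, h1, h3, h5, fun w hw => (h6 w hw).imp_right Or.symm⟩

lemma exists_nbr {v : V} (hd : (G.neighborSet v).ncard = 3) : ∃ a, G.Adj v a := by
  obtain ⟨x, y, z, h1, h2, h3, he⟩ := Set.ncard_eq_three.1 hd
  refine ⟨x, ?_⟩
  rw [← SimpleGraph.mem_neighborSet, he]; simp

lemma exists_over (hd : ∀ v ∈ S', (G.neighborSet v).ncard = 3) (v : V) :
    ∃ p : ExpandVerts G S', p.1.1 = v := by
  by_cases hv : v ∈ S'
  · obtain ⟨a, ha⟩ := exists_nbr (hd v hv)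
    exact ⟨liftV S' ha, liftV_fst ha⟩
  · exact ⟨⟨(v, none), Or.inl ⟨hv, rfl⟩⟩, rfl⟩

lemma expand_reach (s : Set (ExpandVerts G S')) (T : Set V)
    (hT : ∀ p : ExpandVerts G S', p.1.1 ∉ T → p ∉ s) {x y : (Tᶜ : Set V)}
    (w : (G.induce (Tᶜ : Set V)).Walk x y) :
    ∀ (p q : ExpandVerts G S') (hp : p.1.1 = x) (hq : q.1.1 = y),
      ((expand G S').induce (sᶜ : Set _)).Reachable
        ⟨p, hT p (by rw [hp]; exact x.2)⟩ ⟨q, hT q (by rw [hq]; exact y.2)⟩ := by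
  have same : ∀ (p q : ExpandVerts G S') (hp : p ∉ s) (hq : q ∉ s) (h : p.1.1 = q.1.1),
      ((expand G S').induce (sᶜ : Set _)).Reachable ⟨p, hp⟩ ⟨q, hq⟩ := by
    intro p q hp hq h
    by_cases e : p = q
    · subst e; exact SimpleGraph.Reachable.refl _
    · apply SimpleGraph.Adj.reachable
      exact expand_adj.2 (Or.inl ⟨h, e⟩)
  induction w with
  | nil =>
    intro p q hp hq
    exact same _ _ _ _ (hp.trans hq.symm)
  | @cons x z y h w ih =>
    intro p q hp hq
    have h' : G.Adj (x : V) (z : V) := h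
    have e1 := liftV_fst (S' := S') h'
    have e2 := liftV_fst (S' := S') h'.symm
    have m1 : liftV S' h' ∉ s := hT _ (by rw [e1]; exact x.2)
    have m2 : liftV S' h'.symm ∉ s := hT _ (by rw [e2]; exact z.2)
    refine (same p (liftV S' h') _ m1 (hp.trans e1.symm)).trans ?_
    refine SimpleGraph.Reachable.trans (v := ⟨liftV S' h'.symm, m2⟩) ?_ (ih _ _ e2 hq)
    exact SimpleGraph.Adj.reachable (expand_adj_lift h')

lemma expand_threeConnected [Fintype V] (hd : ∀ v ∈ S', (G.neighborSet v).ncard = 3)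
    (hG : ThreeConnected G) : ThreeConnected (expand G S') := by
  classical
  refine ⟨hG.1.trans ?_, ?_⟩
  · exact Fintype.card_le_of_surjective (fun p : ExpandVerts G S' => p.1.1) (exists_over hd)
  intro s hs
  set T : Set V := (fun p : ExpandVerts G S' => p.1.1) '' s with hTdef
  have hTc : T.ncard ≤ 2 := (Set.ncard_image_le s.toFinite).trans hs
  have hconn := hG.2 T hTc
  have hT : ∀ p : ExpandVerts G S', p.1.1 ∉ T → p ∉ s := fun p hp hps => hp ⟨p, hps, rfl⟩
  -- every vertex reaches one outside of the fibres over `T`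
  have key : ∀ (p : ExpandVerts G S') (hp : p ∉ s), ∃ (q : ExpandVerts G S') (hq : q.1.1 ∉ T),
      ((expand G S').induce (sᶜ : Set _)).Reachable ⟨p, hp⟩ ⟨q, hT q hq⟩ := by
    intro p hp
    by_cases hpT : p.1.1 ∈ T
    swap
    · exact ⟨p, hpT, SimpleGraph.Reachable.refl _⟩
    obtain ⟨r, hrs, hr⟩ := hpT
    simp only at hr
    have hpS : p.1.1 ∈ S' := by
      by_contra h
      exact hp ((eq_of_fst_not_mem h hr.symm) ▸ hrs)
    obtain ⟨w, hw, hpw⟩ := exists_liftV_of_mem hpS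
    have ew := liftV_fst (S' := S') hw.symm
    by_cases hwT : w ∈ T
    swap
    · refine ⟨liftV S' hw.symm, by rw [ew]; exact hwT, SimpleGraph.Adj.reachable ?_⟩
      change (expand G S').Adj p _
      conv_lhs => rw [hpw]
      exact expand_adj_lift hw
    obtain ⟨r', hrs', hr'⟩ := hwT
    simp only at hr'
    have hrr : r ≠ r' := by
      rintro rfl
      exact hw.ne (hr.symm.trans hr')
    have hs2 : s = {r, r'} := by
      symm
      apply Set.eq_of_subset_of_ncard_le
      · intro z hz
        rcases hz with rfl | rfl <;> assumption
      · rw [Set.ncard_pair hrr]; exact hs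
      · exact s.toFinite
    have hrS : r.1.1 ∈ S' := hr ▸ hpS
    obtain ⟨c, hc, hrc⟩ := exists_liftV_of_mem hrS
    have hc' : G.Adj p.1.1 c := hr ▸ hc
    have hrc' : r = liftV S' hc' := by
      rw [hrc]; congr 1 
    have hcw : w ≠ c := by
      rintro rfl
      exact hp (by rw [hpw, ← hrc']; exact hrs)
    obtain ⟨d, hd1, hd2, hd3, -⟩ := third_nbr (hd _ hpS) hw hc' hcw
    have e1 := liftV_fst (S' := S') hd1
    have e2 := liftV_fst (S' := S') hd1.symm
    have m1 : liftV S' hd1 ∉ s := by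
      rw [hs2]
      rintro (h | h)
      · rw [hrc', liftV_inj_mem _ _ hpS] at h
        exact hd3 h
      · have : r'.1.1 = p.1.1 := by rw [← h, e1]
        exact hw.ne (this.symm.trans hr')
    have m2 : d ∉ T := by
      rintro ⟨z, hz, hzd⟩
      rw [hs2] at hz
      rcases hz with rfl | rfl
      · exact hd1.ne (hr.symm.trans hzd)
      · exact hd2 (hzd.symm.trans hr')
    refine ⟨liftV S' hd1.symm, by rw [e2]; exact m2, ?_⟩
    refine SimpleGraph.Reachable.trans (v := ⟨liftV S' hd1, m1⟩) ?_ ?_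
    · apply SimpleGraph.Adj.reachable
      refine expand_adj.2 (Or.inl ⟨e1.symm, ?_⟩)
      intro h
      exact hd2 ((liftV_inj_mem hw hd1 hpS).1 (hpw.symm.trans h)).symm
    · exact SimpleGraph.Adj.reachable (expand_adj_lift hd1)
  have : Nonempty (sᶜ : Set (ExpandVerts G S')) := by
    obtain ⟨x⟩ := hconn.nonempty
    obtain ⟨p, hp⟩ := exists_over (S' := S') hd x.1
    exact ⟨⟨p, hT p (by rw [hp]; exact x.2)⟩⟩
  refine SimpleGraph.Connected.mk ?_
  rintro ⟨p, hp⟩ ⟨q, hq⟩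
  obtain ⟨p', hp', h1⟩ := key p hp
  obtain ⟨q', hq', h2⟩ := key q hq
  refine h1.trans (SimpleGraph.Reachable.trans ?_ h2.symm)
  obtain ⟨w⟩ := hconn.preconnected ⟨p'.1.1, hp'⟩ ⟨q'.1.1, hq'⟩
  exact expand_reach s T hT w p' q' rfl rfl

end ExpandConn

section ExpandPM

variable {V : Type*} {G : SimpleGraph V} {S' : Set V}

/-- `p` is the end of a lifted edge of `F`. -/
def outV (F : SimpleGraph V) (p : ExpandVerts G S') : Prop :=
  ∃ w, ∃ h : G.Adj p.1.1 w, F.Adj p.1.1 w ∧ p = liftV S' h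

/-- The relation on the expansion induced by `F`, avoiding the vertices in `X`. -/
def mRel (F : SimpleGraph V) (X : Set (ExpandVerts G S')) (p q : ExpandVerts G S') : Prop :=
  p ∉ X ∧ q ∉ X ∧ ((p.1.1 = q.1.1 ∧ p ≠ q ∧ ¬ outV F p ∧ ¬ outV F q) ∨
    ∃ h : G.Adj p.1.1 q.1.1, F.Adj p.1.1 q.1.1 ∧ p = liftV S' h ∧ q = liftV S' h.symm)

lemma mRel_symm {F : SimpleGraph V} {X : Set (ExpandVerts G S')} {p q : ExpandVerts G S'}
    (h : mRel F X p q) : mRel F X q p := by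
  obtain ⟨h1, h2, ⟨h3, h4, h5, h6⟩ | ⟨h3, h4, h5, h6⟩⟩ := h
  · exact ⟨h2, h1, Or.inl ⟨h3.symm, h4.symm, h6, h5⟩⟩
  · exact ⟨h2, h1, Or.inr ⟨h3.symm, h4.symm, h6, h5⟩⟩

lemma mRel_adj {F : SimpleGraph V} {X : Set (ExpandVerts G S')} {p q : ExpandVerts G S'}
    (h : mRel F X p q) : (expand G S').Adj p q := by
  obtain ⟨h1, h2, ⟨h3, h4, h5, h6⟩ | ⟨h3, h4, h5, h6⟩⟩ := h
  · exact expand_adj.2 (Or.inl ⟨h3, h4⟩)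
  · exact expand_adj.2 (Or.inr ⟨h3, h5, h6⟩)

lemma outV_lift {F : SimpleGraph V} {v w : V} (h : G.Adj v w) (hF : F.Adj v w) :
    outV F (liftV S' h) := by
  have e := liftV_fst (S' := S') h
  refine ⟨w, by rw [e]; exact h, by rw [e]; exact hF, ?_⟩
  congr 1; exact e.symm

lemma outV_lift_iff {F : SimpleGraph V} {v w : V} (h : G.Adj v w) (hv : v ∈ S') :
    outV F (liftV S' h) ↔ F.Adj v w := by
  refine ⟨?_, outV_lift h⟩
  rintro ⟨w', h', hF, e⟩
  have e' := liftV_fst (S' := S') h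
  have h'' : G.Adj v w' := by rw [e'] at h'; exact h'
  rw [e'] at hF
  have : liftV S' h = liftV S' h'' := by
    rw [e]; congr 1 
  rw [liftV_inj_mem _ _ hv] at this
  rw [this]; exact hF

lemma mRel_existsUnique {F : SimpleGraph V} {X : Set (ExpandVerts G S')}
    (h1 : F ≤ G) (h2 : ∀ v, v ∉ S' → ∀ w w', F.Adj v w → F.Adj v w' → w = w')
    (h3 : ∀ x ∈ X, ¬ outV F x)
    (h4 : ∀ p, p ∉ X → ¬ outV F p →
      ∃! q : ExpandVerts G S', p.1.1 = q.1.1 ∧ p ≠ q ∧ ¬ outV F q ∧ q ∉ X)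
    (p : ExpandVerts G S') (hp : p ∉ X) : ∃! q, mRel F X p q := by
  by_cases ho : outV F p
  · obtain ⟨w, h, hF, e⟩ := ho
    have ew := liftV_fst (S' := S') h.symm
    refine ⟨liftV S' h.symm, ⟨hp, fun hx => h3 _ hx (outV_lift _ hF.symm), Or.inr ?_⟩, ?_⟩
    · refine ⟨by rw [ew]; exact h, by rw [ew]; exact hF, ?_, ?_⟩
      · conv_lhs => rw [e]
        congr 1; exact ew.symm
      · congr 1; exact ew.symm
    · rintro q ⟨-, -, ⟨-, -, hn, -⟩ | ⟨h', hF', e1, e2⟩⟩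
      · exact absurd ⟨w, h, hF, e⟩ hn
      · have : q.1.1 = w := by
          by_cases hS : p.1.1 ∈ S'
          · exact (liftV_inj_mem _ _ hS).1 (e1.symm.trans e)
          · exact h2 _ hS _ _ hF' hF
        subst this
        exact e2
  · obtain ⟨q, ⟨a1, a2, a3, a4⟩, hu⟩ := h4 p hp ho
    refine ⟨q, ⟨hp, a4, Or.inl ⟨a1, a2, ho, a3⟩⟩, ?_⟩
    rintro q' ⟨-, b, ⟨b1, b2, -, b3⟩ | ⟨h', hF', e1, e2⟩⟩
    · exact hu q' ⟨b1, b2, b3, b⟩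
    · exact absurd ⟨_, h', hF', e1⟩ ho

/-- The form of bicriticality we use: subgraphs `F` in place of perfect matchings. -/
def BicF (G : SimpleGraph V) : Prop :=
  ∀ x y : V, x ≠ y → ∃ F : SimpleGraph V, F ≤ G ∧ (∀ w, ¬ F.Adj x w) ∧ (∀ w, ¬ F.Adj y w) ∧
    ∀ v, v ≠ x → v ≠ y → ∃! w, F.Adj v w

/-- Fibre analysis: three vertices over `v ∈ S'`. -/
lemma fibre_cases (hd : ∀ v ∈ S', (G.neighborSet v).ncard = 3) (p : ExpandVerts G S')
    (hp : p.1.1 ∈ S') {a : V} (ha : G.Adj p.1.1 a) (hne : p ≠ liftV S' ha) :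
    ∃ q : ExpandVerts G S', p.1.1 = q.1.1 ∧ p ≠ q ∧ q ≠ liftV S' ha ∧
      ∀ r : ExpandVerts G S', p.1.1 = r.1.1 → r = p ∨ r = q ∨ r = liftV S' ha := by
  obtain ⟨w, hw, e⟩ := exists_liftV_of_mem hp
  have haw : a ≠ w := by
    rintro rfl
    exact hne e
  obtain ⟨c, hc, hca, hcw, hall⟩ := third_nbr (hd _ hp) ha hw haw
  refine ⟨liftV S' hc, (liftV_fst hc).symm, ?_, ?_, ?_⟩
  · intro h
    exact hcw ((liftV_inj_mem hw hc hp).1 (e.symm.trans h)).symm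
  · intro h
    exact hca ((liftV_inj_mem _ _ hp).1 h)
  · intro r hr
    obtain ⟨z, hz, ez⟩ := exists_liftV_of_mem (p := r) (hr ▸ hp)
    have hz' : G.Adj p.1.1 z := by rw [hr]; exact hz
    have ez' : r = liftV S' hz' := by
      conv_lhs => rw [ez]
      congr 1; exact hr.symm
    rcases hall z hz' with rfl | rfl | rfl
    · exact Or.inr (Or.inr ez')
    · exact Or.inl (ez'.trans e.symm)
    · exact Or.inr (Or.inl ez')

lemma pm_of_mRel {F : SimpleGraph V} {x y : ExpandVerts G S'}
    (h : ∀ p : ExpandVerts G S', p ∉ ({x, y} : Set _) → ∃! q, mRel F {x, y} p q) :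
    ∃ M : ((expand G S').induce {v | v ≠ x ∧ v ≠ y}).Subgraph, M.IsPerfectMatching := by
  refine ⟨{ verts := Set.univ
            Adj := fun p q => mRel F {x, y} p.1 q.1
            adj_sub := fun h => mRel_adj h
            edge_vert := fun _ => trivial
            symm := ⟨fun _ _ h => mRel_symm h⟩ }, ?_⟩
  rw [SimpleGraph.Subgraph.isPerfectMatching_iff]
  rintro ⟨p, hp⟩
  obtain ⟨q, hq, hu⟩ := h p (by simpa using hp)
  refine ⟨⟨q, by have := hq.2.1; simpa using this⟩, hq, ?_⟩
  rintro ⟨q', hq'⟩ h'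
  exact Subtype.ext (hu q' h')

/-- unmatched vertices, generic fibre -/
lemma fibre_generic (hd : ∀ v ∈ S', (G.neighborSet v).ncard = 3) {F : SimpleGraph V}
    (hF : F ≤ G) (p : ExpandVerts G S') (hu : ∃! w, F.Adj p.1.1 w) (ho : ¬ outV F p) :
    ∃! q : ExpandVerts G S', p.1.1 = q.1.1 ∧ p ≠ q ∧ ¬ outV F q := by
  obtain ⟨w, hw, huw⟩ := hu
  have hp : p.1.1 ∈ S' := by
    by_contra hp
    exact ho ⟨w, hF hw, hw, eq_liftV_of_not_mem hp _⟩
  have hne : p ≠ liftV S' (hF hw) := fun h => ho ⟨w, hF hw, hw, h⟩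
  obtain ⟨q, h1, h2, h3, h4⟩ := fibre_cases hd p hp (hF hw) hne
  refine ⟨q, ⟨h1, h2, ?_⟩, ?_⟩
  · rintro ⟨w', hw', hFw, e⟩
    have : w' = w := huw w' (by rw [h1]; exact hFw)
    subst this
    apply h3
    conv_lhs => rw [e]
    congr 1; exact h1.symm
  · rintro r ⟨r1, r2, r3⟩
    rcases h4 r r1 with h | h | h
    · exact absurd h.symm r2
    · exact h
    · exact absurd (h ▸ outV_lift (hF hw) hw) r3

lemma expand_bicritical (hd : ∀ v ∈ S', (G.neighborSet v).ncard = 3) (hG : BicF G)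
    (x y : ExpandVerts G S') (hxy : x ≠ y) :
    ∃ M : ((expand G S').induce {v | v ≠ x ∧ v ≠ y}).Subgraph, M.IsPerfectMatching := by
  classical
  by_cases hv : x.1.1 = y.1.1
  · have hxS : x.1.1 ∈ S' := by
      by_contra h
      exact hxy (eq_of_fst_not_mem h hv)
    obtain ⟨b, hb, hyb⟩ := exists_liftV_of_mem (p := y) (hv ▸ hxS)
    have hb' : G.Adj x.1.1 b := by rw [hv]; exact hb
    have hyb' : y = liftV S' hb' := by
      conv_lhs => rw [hyb]
      congr 1; exact hv.symm
    obtain ⟨z, z1, z2, z3, z4⟩ := fibre_cases hd x hxS hb' (hyb' ▸ hxy)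
    rw [← hyb'] at z3 z4
    obtain ⟨c, hc, hzc⟩ := exists_liftV_of_mem (p := z) (z1 ▸ hxS)
    have hc' : G.Adj x.1.1 c := by rw [z1]; exact hc
    have hzc' : z = liftV S' hc' := by
      conv_lhs => rw [hzc]
      congr 1; exact z1.symm
    obtain ⟨F0, f1, f2, f3, f4⟩ := hG x.1.1 c hc'.ne
    let F : SimpleGraph V := F0 ⊔ SimpleGraph.edge x.1.1 c
    have Fadj : ∀ v w, F.Adj v w ↔ F0.Adj v w ∨ (v = x.1.1 ∧ w = c) ∨ (v = c ∧ w = x.1.1) := by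
      intro v w
      have := hc'.ne
      simp only [F, SimpleGraph.sup_adj, SimpleGraph.edge_adj]
      grind
    have hFG : F ≤ G := by
      intro v w h
      rw [Fadj] at h
      rcases h with h | ⟨rfl, rfl⟩ | ⟨rfl, rfl⟩
      · exact f1 h
      · exact hc'
      · exact hc'.symm
    have hF1 : ∀ v, ∃! w, F.Adj v w := by
      intro v
      simp only [Fadj]
      have := hc'.ne
      by_cases e1 : v = x.1.1
      · refine ⟨c, Or.inr (Or.inl ⟨e1, rfl⟩), ?_⟩
        rintro w (h | h | h)
        · exact absurd (e1 ▸ h) (f2 w)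
        · exact h.2
        · exact absurd (e1.symm.trans h.1) this
      by_cases e2 : v = c
      · refine ⟨x.1.1, Or.inr (Or.inr ⟨e2, rfl⟩), ?_⟩
        rintro w (h | h | h)
        · exact absurd (e2 ▸ h) (f3 w)
        · exact absurd h.1 e1
        · exact h.2
      obtain ⟨w, hw, hu⟩ := f4 v e1 e2
      refine ⟨w, Or.inl hw, ?_⟩
      rintro w' (h | h | h)
      · exact hu _ h
      · exact absurd h.1 e1
      · exact absurd h.1 e2
    have hxc : F.Adj x.1.1 c := by rw [Fadj]; exact Or.inr (Or.inl ⟨rfl, rfl⟩)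
    have hout : ∀ p : ExpandVerts G S', x.1.1 = p.1.1 → outV F p → p = z := by
      rintro p hp ⟨w, h, hFw, e⟩
      have : w = c := (hF1 x.1.1).unique (by rw [hp]; exact hFw) hxc
      subst this
      rw [e, hzc']
      congr 1; exact hp.symm
    have hox : ¬ outV F x := fun h => z2 (hout x rfl h)
    have hoy : ¬ outV F y := fun h => z3 (hout y hv h).symm
    apply pm_of_mRel (F := F)
    apply mRel_existsUnique hFG
    · intro v _ w w' h h'
      exact (hF1 v).unique h h'
    · rintro p (rfl | rfl)
      · exact hox
      · exact hoy
    · intro p hp ho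
      have hpx : p.1.1 ≠ x.1.1 := by
        intro e
        rcases z4 p e.symm with h | h | h
        · exact hp (Or.inl h)
        · rw [h, hzc'] at ho
          exact ho (outV_lift hc' hxc)
        · exact hp (Or.inr h)
      obtain ⟨q, ⟨q1, q2, q3⟩, qu⟩ := fibre_generic hd hFG p (hF1 _) ho
      refine ⟨q, ⟨q1, q2, q3, ?_⟩, fun r hr => qu r ⟨hr.1, hr.2.1, hr.2.2.1⟩⟩
      rintro (rfl | rfl)
      · exact hpx q1
      · exact hpx (q1.trans hv.symm)
  · obtain ⟨F, f1, f2, f3, f4⟩ := hG _ _ hv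
    apply pm_of_mRel (F := F)
    have hdel : ∀ z z' : ExpandVerts G S', z.1.1 ≠ z'.1.1 → (∀ w, ¬ F.Adj z.1.1 w) →
        ∀ p : ExpandVerts G S', p.1.1 = z.1.1 → p ≠ z →
        ∃! q : ExpandVerts G S', p.1.1 = q.1.1 ∧ p ≠ q ∧ ¬ outV F q ∧ q ≠ z ∧ q ≠ z' := by
      intro z z' hzz hz p hpz hne
      have hp : p.1.1 ∈ S' := by
        by_contra h
        exact hne (eq_of_fst_not_mem h hpz)
      obtain ⟨a, ha, e⟩ := exists_liftV_of_mem (p := z) (hpz ▸ hp)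
      have ha' : G.Adj p.1.1 a := by rw [hpz]; exact ha
      have e' : z = liftV S' ha' := by
        conv_lhs => rw [e]
        congr 1; exact hpz.symm
      obtain ⟨q, q1, q2, q3, q4⟩ := fibre_cases hd p hp ha' (e' ▸ hne)
      rw [← e'] at q3 q4
      refine ⟨q, ⟨q1, q2, ?_, q3, ?_⟩, ?_⟩
      · rintro ⟨w, h, hFw, -⟩
        rw [← q1, hpz] at hFw
        exact hz w hFw
      · rintro rfl
        exact hzz (hpz.symm.trans q1)
      · rintro r ⟨r1, r2, r3, r4, r5⟩
        rcases q4 r r1 with h | h | h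
        · exact absurd h.symm r2
        · exact h
        · exact absurd h r4
    apply mRel_existsUnique f1
    · intro v _ w w' h h'
      have h1 : v ≠ x.1.1 := by rintro rfl; exact f2 w h
      have h2 : v ≠ y.1.1 := by rintro rfl; exact f3 w h
      exact (f4 v h1 h2).unique h h'
    · rintro p (rfl | rfl) ⟨w, h, hFw, -⟩
      · exact f2 w hFw
      · exact f3 w hFw
    · intro p hp ho
      simp only [Set.mem_insert_iff, Set.mem_singleton_iff, not_or] at hp ⊢
      by_cases h1 : p.1.1 = x.1.1
      · exact hdel x y hv f2 p h1 hp.1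
      by_cases h2 : p.1.1 = y.1.1
      · obtain ⟨q, hq, hu⟩ := hdel y x (Ne.symm hv) f3 p h2 hp.2
        exact ⟨q, ⟨hq.1, hq.2.1, hq.2.2.1, hq.2.2.2.2, hq.2.2.2.1⟩, fun r hr =>
          hu r ⟨hr.1, hr.2.1, hr.2.2.1, hr.2.2.2.2, hr.2.2.2.1⟩⟩
      obtain ⟨q, ⟨q1, q2, q3⟩, qu⟩ := fibre_generic hd f1 p (f4 _ h1 h2) ho
      refine ⟨q, ⟨q1, q2, q3, ?_, ?_⟩, fun r hr => qu r ⟨hr.1, hr.2.1, hr.2.2.1⟩⟩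
      · rintro rfl
        exact h1 q1
      · rintro rfl
        exact h2 q1

/-- Configurations: subgraphs of `G` with prescribed degrees. -/
def ConfSet (G : SimpleGraph V) (S' : Set V) : Set (SimpleGraph V) :=
  {F | F ≤ G ∧ ∀ v, (∃! w, F.Adj v w) ∨ (v ∈ S' ∧ ∀ w, G.Adj v w → F.Adj v w)}

/-- The perfect matching associated with a configuration. -/
def confPM (S' : Set V) (F : SimpleGraph V) : (expand G S').Subgraph where
  verts := Set.univ
  Adj := mRel F ∅
  adj_sub := mRel_adj
  edge_vert := fun _ => trivial
  symm := ⟨fun _ _ h => mRel_symm h⟩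

lemma confPM_lift {F : SimpleGraph V} {v w : V} (h : G.Adj v w) :
    (confPM (G := G) S' F).Adj (liftV S' h) (liftV S' h.symm) ↔ F.Adj v w := by
  have e1 := liftV_fst (S' := S') h
  have e2 := liftV_fst (S' := S') h.symm
  constructor
  · rintro ⟨-, -, ⟨h1, -⟩ | ⟨h1, h2, -⟩⟩
    · rw [e1, e2] at h1
      exact absurd h1 h.ne
    · rwa [e1, e2] at h2
  · intro hF
    refine ⟨by simp, by simp, Or.inr ⟨by rw [e1, e2]; exact h, by rw [e1, e2]; exact hF, ?_, ?_⟩⟩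
      <;> congr 1 <;> simp [e1, e2]

lemma numPM_expand (hd : ∀ v ∈ S', (G.neighborSet v).ncard = 3) :
    numPM (expand G S') = (ConfSet G S').ncard := by
  classical
  unfold numPM
  symm
  refine Set.ncard_congr (fun F _ => confPM (G := G) S' F) ?_ ?_ ?_
  · rintro F ⟨hF, hc⟩
    change (confPM (G := G) S' F).IsPerfectMatching
    rw [SimpleGraph.Subgraph.isPerfectMatching_iff]
    intro p
    refine mRel_existsUnique hF ?_ (by simp) ?_ p (by simp)
    · intro v hv w w' h h'
      rcases hc v with h1 | h1
      · exact h1.unique h h'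
      · exact absurd h1.1 hv
    · intro p _ ho
      have h1 : ∃! w, F.Adj p.1.1 w := by
        rcases hc p.1.1 with h1 | ⟨h1, h2⟩
        · exact h1
        · obtain ⟨w, h, e⟩ := exists_liftV_of_mem h1
          exact absurd ⟨w, h, h2 w h, e⟩ ho
      simpa using fibre_generic hd hF p h1 ho
  · rintro F F' ⟨hF, -⟩ ⟨hF', -⟩ e
    ext v w
    constructor
    · intro h
      rw [← confPM_lift (S' := S') (hF h), ← e, confPM_lift]; exact h
    · intro h
      rw [← confPM_lift (S' := S') (hF' h), e, confPM_lift]; exact h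
  · intro M hM
    have hM' := SimpleGraph.Subgraph.isPerfectMatching_iff.1 hM
    let F : SimpleGraph V :=
      { Adj := fun v w => ∃ h : G.Adj v w, M.Adj (liftV S' h) (liftV S' h.symm)
        symm := ⟨fun v w ⟨h, h'⟩ => ⟨h.symm, h'.symm⟩⟩
        loopless := ⟨fun v ⟨h, _⟩ => h.ne rfl⟩ }
    have hFG : F ≤ G := fun v w h => h.1
    have hFadj : ∀ v w, F.Adj v w ↔ ∃ h : G.Adj v w, M.Adj (liftV S' h) (liftV S' h.symm) :=
      fun v w => Iff.rfl
    -- the edges of `M` between different fibres are lifted edges of `F`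
    have hcross : ∀ p q : ExpandVerts G S', M.Adj p q → p.1.1 ≠ q.1.1 →
        ∃ h : G.Adj p.1.1 q.1.1, F.Adj p.1.1 q.1.1 ∧ p = liftV S' h ∧ q = liftV S' h.symm := by
      intro p q hpq hne
      rcases expand_adj.1 (M.adj_sub hpq) with h | ⟨h, e1, e2⟩
      · exact absurd h.1 hne
      · exact ⟨h, ⟨h, by rw [← e1, ← e2]; exact hpq⟩, e1, e2⟩
    have hout : ∀ p q : ExpandVerts G S', M.Adj p q → (outV F p ↔ p.1.1 ≠ q.1.1) := by
      intro p q hpq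
      constructor
      · rintro ⟨w, h, ⟨h', hM1⟩, e⟩ heq
        rw [← e] at hM1
        have := (hM' p).unique hpq hM1
        rw [this, liftV_fst] at heq
        exact h.ne heq
      · intro hne
        obtain ⟨h, h1, h2, h3⟩ := hcross p q hpq hne
        exact ⟨_, h, h1, h2⟩
    have hin : ∀ p q : ExpandVerts G S', p.1.1 = q.1.1 → p ≠ q → ¬ outV F p → ¬ outV F q →
        M.Adj p q := by
      intro p q h1 h2 h3 h4
      obtain ⟨p', hp', -⟩ := hM' p
      obtain ⟨q', hq', -⟩ := hM' q
      have e1 : p.1.1 = p'.1.1 := by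
        by_contra h; exact h3 ((hout p p' hp').2 h)
      have e2 : q.1.1 = q'.1.1 := by
        by_contra h; exact h4 ((hout q q' hq').2 h)
      have hpS : p.1.1 ∈ S' := by
        by_contra h
        exact h2 (eq_of_fst_not_mem h h1)
      by_contra hno
      have hqS : q.1.1 ∈ S' := h1 ▸ hpS
      obtain ⟨a, ha, ea⟩ := exists_liftV_of_mem hqS
      have ha' : G.Adj p.1.1 a := by rw [h1]; exact ha
      have ea' : q = liftV S' ha' := by
        conv_lhs => rw [ea]
        congr 1; exact h1.symm
      obtain ⟨r, r1, r2, r3, r4⟩ := fibre_cases hd p hpS ha' (ea' ▸ h2)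
      rw [← ea'] at r3 r4
      have c1 : p' = r := by
        rcases r4 p' e1 with h | h | h
        · exact absurd h hp'.adj_sub.ne'
        · exact h
        · exact absurd (h ▸ hp') hno
      have c2 : q' = r := by
        rcases r4 q' (h1.trans e2) with h | h | h
        · exact absurd (h ▸ hq').symm hno
        · exact h
        · exact absurd h hq'.adj_sub.ne'
      subst c1
      rw [c2] at hq'
      exact h2 ((hM' p').unique hp'.symm hq'.symm)
    refine ⟨F, ⟨hFG, ?_⟩, ?_⟩
    · intro v
      by_cases hv : v ∈ S'
      · by_cases hall : ∀ w, G.Adj v w → F.Adj v w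
        · exact Or.inr ⟨hv, hall⟩
        left
        push Not at hall
        obtain ⟨a, ha, hFa⟩ := hall
        have na : ¬ outV F (liftV S' ha) := by rwa [outV_lift_iff ha hv]
        obtain ⟨q, hq, hqu⟩ := hM' (liftV S' ha)
        have hqv : v = q.1.1 := by
          by_contra h
          exact na ((hout _ _ hq).2 (by rwa [liftV_fst]))
        obtain ⟨b, hb, eb⟩ := exists_liftV_of_mem (p := q) (hqv ▸ hv)
        have hb' : G.Adj v b := by rw [hqv]; exact hb
        have eb' : q = liftV S' hb' := by
          conv_lhs => rw [eb]
          congr 1; exact hqv.symm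
        have nb : ¬ F.Adj v b := by
          rw [← outV_lift_iff (S' := S') hb' hv, ← eb', hout _ _ hq.symm]
          simp [liftV_fst, hqv]
        have hab : a ≠ b := by
          rintro rfl
          exact hq.adj_sub.ne eb'.symm
        obtain ⟨c, hc, hca, hcb, hcall⟩ := third_nbr (hd v hv) ha hb' hab
        obtain ⟨r, hr, -⟩ := hM' (liftV S' hc)
        have hoc : outV F (liftV S' hc) := by
          by_contra hn
          have h1 := hin (liftV S' ha) (liftV S' hc) (by simp [liftV_fst])
            (by rw [Ne, liftV_inj_mem _ _ hv]; exact hca.symm) na hn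
          have := hqu _ h1
          rw [eb', liftV_inj_mem _ _ hv] at this
          exact hcb this
        refine ⟨c, (outV_lift_iff hc hv).1 hoc, ?_⟩
        intro w hw
        rcases hcall w (hFG hw) with rfl | rfl | rfl
        · exact absurd hw hFa
        · exact absurd hw nb
        · rfl
      · left
        obtain ⟨p, hp⟩ := exists_over (S' := S') hd v
        obtain ⟨q, hq, hqu⟩ := hM' p
        have hne : p.1.1 ≠ q.1.1 := by
          intro h
          exact hq.adj_sub.ne (eq_of_fst_not_mem (by rw [hp]; exact hv) h)
        obtain ⟨h, h1, h2, h3⟩ := hcross p q hq hne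
        rw [hp] at h1
        refine ⟨q.1.1, h1, ?_⟩
        rintro w ⟨hw, hMw⟩
        have hpw : p = liftV S' hw := by
          have := eq_liftV_of_not_mem (p := p) (by rw [hp]; exact hv) (by rw [hp]; exact hw)
          rw [this]; congr 1
        rw [← hpw] at hMw
        have := hqu _ hMw
        rw [← this, liftV_fst]
    · have : (confPM (G := G) S' F).Adj = M.Adj := by
        ext p q
        constructor
        · rintro ⟨-, -, ⟨h1, h2, h3, h4⟩ | ⟨h, ⟨_, h1⟩, h2, h3⟩⟩
          · exact hin p q h1 h2 h3 h4
          · rw [← h2, ← h3] at h1; exact h1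
        · intro hpq
          refine ⟨by simp, by simp, ?_⟩
          by_cases h : p.1.1 = q.1.1
          · left
            refine ⟨h, hpq.adj_sub.ne, ?_, ?_⟩
            · rw [hout _ _ hpq]; simpa using h
            · rw [hout _ _ hpq.symm]; simpa using h.symm
          · exact Or.inr (hcross p q hpq h)
      refine SimpleGraph.Subgraph.ext ?_ this
      exact (hM.2.verts_eq_univ).symm

end ExpandPM

section ExpandCard

variable {V : Type*} {G : SimpleGraph V} {S' : Set V}

open Classical in
lemma fibre_card [Fintype V] (hd : ∀ v ∈ S', (G.neighborSet v).ncard = 3) (v : V) :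
    (Finset.univ.filter (fun p : ExpandVerts G S' => p.1.1 = v)).card
      = 1 + 2 * (if v ∈ S' then 1 else 0) := by
  by_cases hv : v ∈ S'
  · rw [if_pos hv]
    obtain ⟨a, ha⟩ := exists_nbr (hd v hv)
    obtain ⟨b, c, hb, hc, hba, hca, hbc, hall⟩ := other_nbr (hd v hv) ha
    rw [Finset.card_eq_three]
    refine ⟨liftV S' ha, liftV S' hb, liftV S' hc, ?_, ?_, ?_, ?_⟩
    · rw [Ne, liftV_inj_mem _ _ hv]; exact hba.symm
    · rw [Ne, liftV_inj_mem _ _ hv]; exact hca.symm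
    · rw [Ne, liftV_inj_mem _ _ hv]; exact hbc
    · ext p
      simp only [Finset.mem_filter, Finset.mem_univ, true_and, Finset.mem_insert,
        Finset.mem_singleton]
      constructor
      · intro hp
        subst hp
        obtain ⟨w, hw, e⟩ := exists_liftV_of_mem hv
        rcases hall w hw with rfl | rfl | rfl
        · exact Or.inl e
        · exact Or.inr (Or.inl e)
        · exact Or.inr (Or.inr e)
      · rintro (rfl | rfl | rfl) <;> exact liftV_fst _
  · rw [if_neg hv]
    simp only [mul_zero, add_zero]
    rw [Finset.card_eq_one]
    obtain ⟨p, hp⟩ := exists_over (S' := S') hd v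
    refine ⟨p, ?_⟩
    ext q
    simp only [Finset.mem_filter, Finset.mem_univ, true_and, Finset.mem_singleton]
    constructor
    · intro hq
      exact eq_of_fst_not_mem (by rw [hq]; exact hv) (hq.trans hp.symm)
    · rintro rfl; exact hp

lemma sum_ind [Fintype V] (S' : Set V) [DecidablePred (· ∈ S')] :
    ∑ v : V, (if v ∈ S' then 1 else 0) = S'.ncard := by
  rw [Finset.sum_boole, Set.ncard_eq_toFinset_card']
  simp only [Nat.cast_id]
  congr 1
  ext; simp

lemma card_expandVerts [Fintype V] (hd : ∀ v ∈ S', (G.neighborSet v).ncard = 3) :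
    Fintype.card (ExpandVerts G S') = Fintype.card V + 2 * S'.ncard := by
  classical
  rw [← Finset.card_univ, Finset.card_eq_sum_card_fiberwise (f := fun p => p.1.1)
    (t := Finset.univ) (by simp)]
  rw [Finset.sum_congr rfl (fun v _ => fibre_card hd v), Finset.sum_add_distrib, ← Finset.mul_sum,
    sum_ind]
  simp

lemma expand_degree_mem (hd : ∀ v ∈ S', (G.neighborSet v).ncard = 3)
    (p : ExpandVerts G S') (hp : p.1.1 ∈ S') : ((expand G S').neighborSet p).ncard = 3 := by
  obtain ⟨w, hw, e⟩ := exists_liftV_of_mem hp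
  obtain ⟨b, c, hb, hc, hbw, hcw, hbc, hall⟩ := other_nbr (hd _ hp) hw
  rw [Set.ncard_eq_three]
  have ew := liftV_fst (S' := S') hw.symm
  have eb := liftV_fst (S' := S') hb
  have ec := liftV_fst (S' := S') hc
  refine ⟨liftV S' hb, liftV S' hc, liftV S' hw.symm, ?_, ?_, ?_, ?_⟩
  · rw [Ne, liftV_inj_mem _ _ hp]; exact hbc
  · intro h
    rw [h, ew] at eb
    exact hw.ne eb.symm
  · intro h
    rw [h, ew] at ec
    exact hw.ne ec.symm
  · ext q
    simp only [SimpleGraph.mem_neighborSet, Set.mem_insert_iff, Set.mem_singleton_iff]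
    rw [expand_adj]
    constructor
    · rintro (⟨h1, h2⟩ | ⟨h, e1, e2⟩)
      · obtain ⟨z, hz, e'⟩ := exists_liftV_of_mem (p := q) (h1 ▸ hp)
        have hz' : G.Adj p.1.1 z := by rw [h1]; exact hz
        have e'' : q = liftV S' hz' := by
          conv_lhs => rw [e']
          congr 1; exact h1.symm
        rcases hall z hz' with rfl | rfl | rfl
        · exact absurd (e.trans e''.symm) h2
        · exact Or.inl e''
        · exact Or.inr (Or.inl e'')
      · have : q.1.1 = w := (liftV_inj_mem _ _ hp).1 (e1.symm.trans e)
        subst this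
        exact Or.inr (Or.inr e2)
    · rintro (h | h | h)
      · left
        refine ⟨by rw [h, eb], fun h' => hbw ?_⟩
        exact (liftV_inj_mem _ _ hp).1 (h.symm.trans (h'.symm.trans e))
      · left
        refine ⟨by rw [h, ec], fun h' => hcw ?_⟩
        exact (liftV_inj_mem _ _ hp).1 (h.symm.trans (h'.symm.trans e))
      · rw [← expand_adj]
        have := expand_adj_lift (S' := S') hw
        rw [← e, ← h] at this
        exact this

lemma expand_degree_not_mem (p : ExpandVerts G S') (hp : p.1.1 ∉ S') :
    ((expand G S').neighborSet p).ncard = (G.neighborSet p.1.1).ncard := by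
  symm
  refine Set.ncard_congr (fun w (hw : G.Adj p.1.1 w) => liftV S' hw.symm) ?_ ?_ ?_
  · intro w hw
    have := expand_adj_lift (S' := S') (show G.Adj p.1.1 w from hw)
    rw [← eq_liftV_of_not_mem hp] at this
    exact this
  · intro w w' hw hw' e
    have := congrArg (fun q : ExpandVerts G S' => q.1.1) e
    simpa [liftV_fst] using this
  · intro q hq
    rcases expand_adj.1 (show (expand G S').Adj p q from hq) with ⟨h1, h2⟩ | ⟨h, e1, e2⟩
    · exact absurd (eq_of_fst_not_mem hp h1) h2
    · exact ⟨q.1.1, h, e2.symm⟩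

lemma handshake {W : Type*} [Fintype W] (H : SimpleGraph W) :
    ∑ v : W, (H.neighborSet v).ncard = 2 * H.edgeSet.ncard := by
  classical
  have := H.sum_degrees_eq_twice_card_edges
  rw [Set.ncard_eq_toFinset_card']
  rw [SimpleGraph.edgeFinset] at this
  rw [← this]
  refine Finset.sum_congr rfl (fun v _ => ?_)
  rw [Set.ncard_eq_toFinset_card', ← SimpleGraph.card_neighborFinset_eq_degree]
  rfl

lemma card_expandEdges [Fintype V] (hd : ∀ v ∈ S', (G.neighborSet v).ncard = 3) :
    (expand G S').edgeSet.ncard = G.edgeSet.ncard + 3 * S'.ncard := by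
  classical
  have h1 := handshake (expand G S')
  have h2 := handshake G
  have h3 : ∑ p : ExpandVerts G S', ((expand G S').neighborSet p).ncard
      = ∑ v : V, ((G.neighborSet v).ncard + 6 * (if v ∈ S' then 1 else 0)) := by
    rw [← Finset.sum_fiberwise (s := Finset.univ) (g := fun p : ExpandVerts G S' => p.1.1)]
    refine Finset.sum_congr rfl (fun v _ => ?_)
    have : ∀ p ∈ Finset.univ.filter (fun p : ExpandVerts G S' => p.1.1 = v),
        ((expand G S').neighborSet p).ncard = (G.neighborSet v).ncard := by
      intro p hp
      simp only [Finset.mem_filter, Finset.mem_univ, true_and] at hp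
      subst hp
      by_cases hv : p.1.1 ∈ S'
      · rw [expand_degree_mem hd p hv, hd _ hv]
      · rw [expand_degree_not_mem p hv]
    rw [Finset.sum_congr rfl this, Finset.sum_const, fibre_card hd]
    by_cases hv : v ∈ S'
    · simp [hv, hd v hv]
    · simp [hv]
  rw [Finset.sum_add_distrib, ← Finset.mul_sum, sum_ind] at h3
  omega

end ExpandCard

section Encoding

/-- The seven edge variables of one layer: `u¹u²`, `u²u³`, `u³u⁴`, `u²u'`, `u⁴u'`, and the two
links going to the next layer, from `u¹` and from `u⁴`. -/
abbrev Letter : Type := Bool × Bool × Bool × Bool × Bool × Bool × Bool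

abbrev Letter.p (l : Letter) : Bool := l.1
abbrev Letter.q (l : Letter) : Bool := l.2.1
abbrev Letter.r (l : Letter) : Bool := l.2.2.1
abbrev Letter.c (l : Letter) : Bool := l.2.2.2.1
abbrev Letter.d (l : Letter) : Bool := l.2.2.2.2.1
abbrev Letter.a (l : Letter) : Bool := l.2.2.2.2.2.1
abbrev Letter.b (l : Letter) : Bool := l.2.2.2.2.2.2

/-- The vertex type of `G'_t`. -/
abbrev VT (t : ℕ) : Type := (Fin (t + 1) × Fin 4) ⊕ Bool

/-- Oriented edges selected by an assignment of the edge variables. -/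
def encR (t : ℕ) (e g h : Bool) (w : Fin (t + 1) → Letter) : VT t → VT t → Prop
  | Sum.inl (s, i), Sum.inl (s', j) =>
      (s = s' ∧ ((i = 0 ∧ j = 1 ∧ (w s).p) ∨ (i = 1 ∧ j = 2 ∧ (w s).q) ∨
        (i = 2 ∧ j = 3 ∧ (w s).r))) ∨
      ((s' : ℕ) = s + 1 ∧ ((i = 0 ∧ j = 0 ∧ (w s).a) ∨ (i = 3 ∧ j = 2 ∧ (w s).b)))
  | Sum.inl (s, i), Sum.inr false =>
      (s : ℕ) = t ∧ ((i = 0 ∧ (w s).a) ∨ (i = 3 ∧ (w s).b))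
  | Sum.inl (s, i), Sum.inr true =>
      (i = 1 ∧ (w s).c) ∨ (i = 3 ∧ (w s).d) ∨ ((s : ℕ) = 0 ∧ ((i = 0 ∧ e) ∨ (i = 2 ∧ g)))
  | Sum.inr false, Sum.inr true => h
  | Sum.inr _, _ => False

def encF (t : ℕ) (e g h : Bool) (w : Fin (t + 1) → Letter) : SimpleGraph (VT t) :=
  SimpleGraph.fromRel (encR t e g h w)

variable {t : ℕ}

def nextV (s : Fin (t + 1)) (i : Fin 4) : VT t :=
  if h : (s : ℕ) + 1 < t + 1 then Sum.inl (⟨s + 1, h⟩, i) else Sum.inr false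

def prevV (s : Fin (t + 1)) (i : Fin 4) : VT t :=
  if (s : ℕ) = 0 then Sum.inr true else Sum.inl (⟨s - 1, by omega⟩, i)

def prevA (e : Bool) (w : Fin (t + 1) → Letter) (s : Fin (t + 1)) : Bool :=
  if (s : ℕ) = 0 then e else (w ⟨s - 1, by omega⟩).a

def prevB (g : Bool) (w : Fin (t + 1) → Letter) (s : Fin (t + 1)) : Bool :=
  if (s : ℕ) = 0 then g else (w ⟨s - 1, by omega⟩).b

variable (e g h : Bool) (w : Fin (t + 1) → Letter)

lemma encF_inl_inl (s s' : Fin (t + 1)) (i j : Fin 4) :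
    (encF t e g h w).Adj (Sum.inl (s, i)) (Sum.inl (s', j)) ↔
      (encR t e g h w (Sum.inl (s, i)) (Sum.inl (s', j)) ∨
        encR t e g h w (Sum.inl (s', j)) (Sum.inl (s, i))) := by
  rw [encF, SimpleGraph.fromRel_adj]
  constructor
  · exact fun h => h.2
  · refine fun h => ⟨?_, h⟩
    rintro ⟨⟩
    simp only [encR] at h
    rcases h with (⟨-, h⟩ | h) | (⟨-, h⟩ | h)
    · rcases h with ⟨h1, h2, -⟩ | ⟨h1, h2, -⟩ | ⟨h1, h2, -⟩ <;> simp [h1] at h2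
    · omega
    · rcases h with ⟨h1, h2, -⟩ | ⟨h1, h2, -⟩ | ⟨h1, h2, -⟩ <;> simp [h1] at h2
    · omega

lemma encF_inl_inr (s : Fin (t + 1)) (i : Fin 4) (x : Bool) :
    (encF t e g h w).Adj (Sum.inl (s, i)) (Sum.inr x) ↔
      encR t e g h w (Sum.inl (s, i)) (Sum.inr x) := by
  rw [encF, SimpleGraph.fromRel_adj]
  cases x <;> simp [encR]

lemma encF_inr_inr (x y : Bool) :
    (encF t e g h w).Adj (Sum.inr x) (Sum.inr y) ↔ x ≠ y ∧ h = true := by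
  rw [encF, SimpleGraph.fromRel_adj]
  cases x <;> cases y <;> simp [encR]

lemma encF_adj0 (s : Fin (t + 1)) (q : VT t) :
    (encF t e g h w).Adj (Sum.inl (s, 0)) q ↔
      (q = prevV s 0 ∧ prevA e w s) ∨ (q = Sum.inl (s, 1) ∧ (w s).p) ∨
        (q = nextV s 0 ∧ (w s).a) := by
  obtain ⟨s, hs⟩ := s
  rcases q with ⟨⟨s', hs'⟩, j⟩ | x
  · rw [encF_inl_inl]
    simp only [encR, prevV, prevA, nextV]
    by_cases h0 : s = 0 <;> by_cases h1 : s + 1 < t + 1 <;> fin_cases j <;>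
      simp [h0, h1] <;> grind
  · rw [encF_inl_inr]
    simp only [encR, prevV, prevA, nextV]
    cases x <;> by_cases h0 : s = 0 <;> by_cases h1 : s + 1 < t + 1 <;> simp [h0, h1] <;> grind

lemma encF_adj1 (s : Fin (t + 1)) (q : VT t) :
    (encF t e g h w).Adj (Sum.inl (s, 1)) q ↔
      (q = Sum.inl (s, 0) ∧ (w s).p) ∨ (q = Sum.inl (s, 2) ∧ (w s).q) ∨
        (q = Sum.inr true ∧ (w s).c) := by
  obtain ⟨s, hs⟩ := s
  rcases q with ⟨⟨s', hs'⟩, j⟩ | x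
  · rw [encF_inl_inl]
    simp only [encR]
    fin_cases j <;> simp <;> grind
  · rw [encF_inl_inr]
    cases x <;> simp [encR]

lemma encF_adj2 (s : Fin (t + 1)) (q : VT t) :
    (encF t e g h w).Adj (Sum.inl (s, 2)) q ↔
      (q = prevV s 3 ∧ prevB g w s) ∨ (q = Sum.inl (s, 1) ∧ (w s).q) ∨
        (q = Sum.inl (s, 3) ∧ (w s).r) := by
  obtain ⟨s, hs⟩ := s
  rcases q with ⟨⟨s', hs'⟩, j⟩ | x
  · rw [encF_inl_inl]
    simp only [encR, prevV, prevB]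
    by_cases h0 : s = 0 <;> fin_cases j <;> simp [h0] <;> grind
  · rw [encF_inl_inr]
    simp only [prevV, prevB]
    cases x <;> by_cases h0 : s = 0 <;> simp [encR, h0]

lemma encF_adj3 (s : Fin (t + 1)) (q : VT t) :
    (encF t e g h w).Adj (Sum.inl (s, 3)) q ↔
      (q = Sum.inl (s, 2) ∧ (w s).r) ∨ (q = Sum.inr true ∧ (w s).d) ∨
        (q = nextV s 2 ∧ (w s).b) := by
  obtain ⟨s, hs⟩ := s
  rcases q with ⟨⟨s', hs'⟩, j⟩ | x
  · rw [encF_inl_inl]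
    simp only [encR, nextV]
    by_cases h1 : s + 1 < t + 1 <;> fin_cases j <;> simp [h1] <;> grind
  · rw [encF_inl_inr]
    simp only [nextV]
    cases x <;> by_cases h1 : s + 1 < t + 1 <;> simp [encR, h1] <;> grind

lemma encF_adju (q : VT t) :
    (encF t e g h w).Adj (Sum.inr false) q ↔
      (q = Sum.inl (Fin.last t, 0) ∧ (w (Fin.last t)).a) ∨
      (q = Sum.inl (Fin.last t, 3) ∧ (w (Fin.last t)).b) ∨ (q = Sum.inr true ∧ h) := by
  rcases q with ⟨⟨s', hs'⟩, j⟩ | x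
  · rw [SimpleGraph.adj_comm, encF_inl_inr]
    simp only [encR]
    fin_cases j <;> simp [Fin.ext_iff] <;> grind
  · rw [encF_inr_inr]
    cases x <;> simp

lemma encF_adju' (q : VT t) :
    (encF t e g h w).Adj (Sum.inr true) q ↔
      ((∃ s, q = Sum.inl (s, 1) ∧ (w s).c) ∨ (∃ s, q = Sum.inl (s, 3) ∧ (w s).d) ∨
      (q = Sum.inl (0, 0) ∧ e) ∨ (q = Sum.inl (0, 2) ∧ g) ∨ (q = Sum.inr false ∧ h)) := by
  rcases q with ⟨⟨s', hs'⟩, j⟩ | x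
  · rw [SimpleGraph.adj_comm, encF_inl_inr]
    simp only [encR]
    fin_cases j <;> simp
  · rw [encF_inr_inr]
    cases x <;> simp

lemma ncard_three {W : Type*} {F : SimpleGraph W} {v n1 n2 n3 : W} {b1 b2 b3 : Bool}
    (h : ∀ q, F.Adj v q ↔ (q = n1 ∧ b1) ∨ (q = n2 ∧ b2) ∨ (q = n3 ∧ b3))
    (h12 : n1 ≠ n2) (h13 : n1 ≠ n3) (h23 : n2 ≠ n3) :
    (F.neighborSet v).ncard = b1.toNat + b2.toNat + b3.toNat := by
  have : F.neighborSet v = {q | (q = n1 ∧ b1) ∨ (q = n2 ∧ b2) ∨ (q = n3 ∧ b3)} := by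
    ext q; exact h q
  rw [this]
  have e3 : ({n3, n2, n1} : Set W).ncard = 3 :=
    Set.ncard_eq_three.2 ⟨n3, n2, n1, h23.symm, h13.symm, h12.symm, rfl⟩
  cases b1 <;> cases b2 <;> cases b3 <;>
    simp [Set.ofPred_or, Set.ncard_pair h12.symm, Set.ncard_pair h13.symm,
      Set.ncard_pair h23.symm, e3]

lemma prevV_ne_nextV (s : Fin (t + 1)) (i j : Fin 4) : prevV s i ≠ nextV s j := by
  unfold prevV nextV
  split <;> split <;> simp

lemma deg0 (s : Fin (t + 1)) : ((encF t e g h w).neighborSet (Sum.inl (s, 0))).ncard =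
    (prevA e w s).toNat + (w s).p.toNat + (w s).a.toNat := by
  refine ncard_three (encF_adj0 e g h w s) ?_ (prevV_ne_nextV s 0 0) ?_
  · unfold prevV; split <;> simp
  · unfold nextV; split <;> simp

lemma deg1 (s : Fin (t + 1)) : ((encF t e g h w).neighborSet (Sum.inl (s, 1))).ncard =
    (w s).p.toNat + (w s).q.toNat + (w s).c.toNat :=
  ncard_three (encF_adj1 e g h w s) (by simp) (by simp) (by simp)

lemma deg2 (s : Fin (t + 1)) : ((encF t e g h w).neighborSet (Sum.inl (s, 2))).ncard =
    (prevB g w s).toNat + (w s).q.toNat + (w s).r.toNat := by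
  refine ncard_three (encF_adj2 e g h w s) ?_ ?_ (by simp)
  · unfold prevV; split <;> simp
  · unfold prevV; split
    · simp
    · simp [Fin.ext_iff]; omega

lemma deg3 (s : Fin (t + 1)) : ((encF t e g h w).neighborSet (Sum.inl (s, 3))).ncard =
    (w s).r.toNat + (w s).d.toNat + (w s).b.toNat := by
  refine ncard_three (encF_adj3 e g h w s) (by simp) ?_ ?_
  · unfold nextV; split <;> simp [Fin.ext_iff]
  · unfold nextV; split <;> simp

lemma degu : ((encF t e g h w).neighborSet (Sum.inr false)).ncard =
    (w (Fin.last t)).a.toNat + (w (Fin.last t)).b.toNat + h.toNat :=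
  ncard_three (encF_adju e g h w) (by simp) (by simp) (by simp)

lemma degu' : ((encF t e g h w).neighborSet (Sum.inr true)).ncard =
    e.toNat + g.toNat + ∑ s, ((w s).c.toNat + (w s).d.toNat) + h.toNat := by
  classical
  have h1 : ((encF t e g h w).neighborSet (Sum.inr true)).ncard =
      ∑ q : VT t, (if (encF t e g h w).Adj (Sum.inr true) q then 1 else 0) := by
    rw [Finset.sum_boole, Set.ncard_eq_toFinset_card']
    simp only [Nat.cast_id]
    congr 1
    ext; simp
  rw [h1, Fintype.sum_sum_type, Fintype.sum_prod_type]
  simp only [Fin.sum_univ_four, encF_adju']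
  have h2 : ∀ s : Fin (t + 1), ((if (s = 0 ∧ e) then 1 else 0) + (w s).c.toNat +
      (if (s = 0 ∧ g) then 1 else 0) + (w s).d.toNat) = 
      (if s = 0 then e.toNat + g.toNat else 0) + ((w s).c.toNat + (w s).d.toNat) := by
    intro s
    by_cases hs : s = 0 <;> cases e <;> cases g <;> simp [hs] <;> ring
  have h3 : ∀ b : Bool, b.toNat = if b = true then 1 else 0 := by decide
  have h4 := Finset.sum_congr (rfl : (Finset.univ : Finset (Fin (t+1))) = Finset.univ) (fun s _ => h2 s)
  have h5 : ∑ s : Fin (t + 1), ((if s = 0 then e.toNat + g.toNat else 0) +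
      ((w s).c.toNat + (w s).d.toNat)) =
      e.toNat + g.toNat + ∑ s, ((w s).c.toNat + (w s).d.toNat) := by
    rw [Finset.sum_add_distrib]; simp
  rw [h5] at h4
  rw [← h4]
  clear h4 h2 h1 h5
  simp [h3]
  cases h <;> simp <;> rfl

end Encoding

section Encoding2

variable {t : ℕ}

abbrev allT : Letter := (true, true, true, true, true, true, true)

lemma G't_eq_encF : G't t = encF t true true true (fun _ => allT) := by
  ext x y
  rcases x with ⟨s, i⟩ | x <;> rcases y with ⟨s', j⟩ | y
  · rw [encF_inl_inl, G't, SimpleGraph.fromRel_adj]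
    obtain ⟨s, hs⟩ := s
    obtain ⟨s', hs'⟩ := s'
    fin_cases i <;> fin_cases j <;> simp [encR, Sset, allT] <;> grind
  · rw [encF_inl_inr, G't, SimpleGraph.fromRel_adj]
    obtain ⟨s, hs⟩ := s
    cases y <;> fin_cases i <;> simp [encR, Sset, allT, Fin.ext_iff] <;>
      exact ⟨⟨s, hs⟩, rfl⟩
  · rw [SimpleGraph.adj_comm, (encF t true true true (fun _ => allT)).adj_comm, encF_inl_inr, G't, SimpleGraph.fromRel_adj]
    obtain ⟨s, hs⟩ := s'
    cases x <;> fin_cases j <;> simp [encR, Sset, allT, Fin.ext_iff] <;>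
      exact ⟨⟨s, hs⟩, rfl⟩
  · rw [encF_inr_inr, G't, SimpleGraph.fromRel_adj]
    cases x <;> cases y <;> simp [Sset]

lemma encF_le (e g h : Bool) (w : Fin (t + 1) → Letter) : encF t e g h w ≤ G't t := by
  rw [G't_eq_encF]
  intro x y hxy
  rcases x with ⟨s, i⟩ | x <;> rcases y with ⟨s', j⟩ | y
  · rw [encF_inl_inl] at *
    simp only [encR, allT] at *
    grind
  · rw [encF_inl_inr] at *
    cases y <;> simp only [encR, allT] at * <;> grind
  · rw [SimpleGraph.adj_comm] at *
    rw [encF_inl_inr] at *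
    cases x <;> simp only [encR, allT] at * <;> grind
  · rw [encF_inr_inr] at *
    simp_all

open Classical in
noncomputable def rdW (F : SimpleGraph (VT t)) (s : Fin (t + 1)) : Letter :=
  (decide (F.Adj (Sum.inl (s, 0)) (Sum.inl (s, 1))), decide (F.Adj (Sum.inl (s, 1)) (Sum.inl (s, 2))),
   decide (F.Adj (Sum.inl (s, 2)) (Sum.inl (s, 3))), decide (F.Adj (Sum.inl (s, 1)) (Sum.inr true)),
   decide (F.Adj (Sum.inl (s, 3)) (Sum.inr true)), decide (F.Adj (Sum.inl (s, 0)) (nextV s 0)),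
   decide (F.Adj (Sum.inl (s, 3)) (nextV s 2)))

open Classical in
lemma encF_rd (F : SimpleGraph (VT t)) (hF : F ≤ G't t) :
    encF t (decide (F.Adj (Sum.inl (0, 0)) (Sum.inr true)))
      (decide (F.Adj (Sum.inl (0, 2)) (Sum.inr true)))
      (decide (F.Adj (Sum.inr false) (Sum.inr true))) (rdW F) = F := by
  rw [G't_eq_encF] at hF
  have key : ∀ x y, encR t true true true (fun _ => allT) x y → 
      (encR t (decide (F.Adj (Sum.inl (0, 0)) (Sum.inr true)))
      (decide (F.Adj (Sum.inl (0, 2)) (Sum.inr true)))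
      (decide (F.Adj (Sum.inr false) (Sum.inr true))) (rdW F) x y ↔ F.Adj x y) := by
    intro x y hxy
    rcases x with ⟨⟨s, hs⟩, i⟩ | x <;> rcases y with ⟨⟨s', hs'⟩, j⟩ | y
    · simp only [encR, allT, rdW, nextV] at *
      fin_cases i <;> fin_cases j <;> simp at * <;> grind
    · cases y <;> simp only [encR, allT, rdW, nextV] at * <;> fin_cases i <;> simp at * <;> grind
    · cases x <;> simp [encR] at hxy
    · cases x <;> cases y <;> simp [encR] at *
  have mono : ∀ x y, encR t (decide (F.Adj (Sum.inl (0, 0)) (Sum.inr true)))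
      (decide (F.Adj (Sum.inl (0, 2)) (Sum.inr true)))
      (decide (F.Adj (Sum.inr false) (Sum.inr true))) (rdW F) x y → 
      encR t true true true (fun _ => allT) x y := by
    intro x y hxy
    rcases x with ⟨⟨s, hs⟩, i⟩ | x <;> rcases y with ⟨⟨s', hs'⟩, j⟩ | y
    · simp only [encR, allT] at *
      grind
    · cases y <;> simp only [encR, allT] at * <;> grind
    · cases x <;> simp [encR] at hxy
    · cases x <;> cases y <;> simp [encR] at *
  ext x y
  constructor
  · intro h
    rw [encF, SimpleGraph.fromRel_adj] at h
    rcases h with ⟨h0, h | h⟩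
    · exact (key _ _ (mono _ _ h)).1 h
    · exact ((key _ _ (mono _ _ h)).1 h).symm
  · intro h
    have h' := hF h
    rw [encF, SimpleGraph.fromRel_adj] at h' ⊢
    refine ⟨h'.1, h'.2.imp (fun h2 => (key _ _ h2).2 h) (fun h2 => (key _ _ h2).2 h.symm)⟩

lemma encF_inj {e g h e' g' h' : Bool} {w w' : Fin (t + 1) → Letter}
    (H : encF t e g h w = encF t e' g' h' w') : e = e' ∧ g = g' ∧ h = h' ∧ w = w' := by
  have K : ∀ x y, (encF t e g h w).Adj x y ↔ (encF t e' g' h' w').Adj x y := by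
    intro x y; rw [H]
  have h1 := K (Sum.inl (0, 0)) (Sum.inr true)
  have h2 := K (Sum.inl (0, 2)) (Sum.inr true)
  have h3 := K (Sum.inr false) (Sum.inr true)
  rw [encF_inl_inr, encF_inl_inr] at h1 h2
  rw [encF_inr_inr, encF_inr_inr] at h3
  simp [encR] at h1 h2 h3
  refine ⟨h1, h2, h3, ?_⟩
  funext s
  have p := K (Sum.inl (s, 0)) (Sum.inl (s, 1))
  have q := K (Sum.inl (s, 1)) (Sum.inl (s, 2))
  have r := K (Sum.inl (s, 2)) (Sum.inl (s, 3))
  have c := K (Sum.inl (s, 1)) (Sum.inr true)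
  have d := K (Sum.inl (s, 3)) (Sum.inr true)
  have a := K (Sum.inl (s, 0)) (nextV s 0)
  have b := K (Sum.inl (s, 3)) (nextV s 2)
  have n1 : nextV s 0 ≠ prevV s 0 := (prevV_ne_nextV s 0 0).symm
  have n2 : nextV s 0 ≠ Sum.inl (s, 1) := by unfold nextV; split <;> simp
  have n3 : nextV s 2 ≠ Sum.inl (s, 2) := by unfold nextV; split <;> simp [Fin.ext_iff]
  have n4 : nextV s 2 ≠ Sum.inr true := by unfold nextV; split <;> simp
  rw [encF_adj0, encF_adj0] at a
  rw [encF_adj3, encF_adj3] at b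
  rw [encF_inl_inr, encF_inl_inr] at c d
  rw [encF_inl_inl, encF_inl_inl] at p q r
  simp [n1, n2, n3, n4, encR] at a b c d p q r
  rcases hw : w s with ⟨_, _, _, _, _, _, _⟩
  rcases hw' : w' s with ⟨_, _, _, _, _, _, _⟩
  simp_all
  exact ⟨p, q, r, c, d, a, b⟩

lemma degG_ne (v : VT t) (hv : v ≠ Sum.inr true) : ((G't t).neighborSet v).ncard = 3 := by
  rw [G't_eq_encF]
  rcases v with ⟨s, j⟩ | x
  · fin_cases j
    · erw [deg0]; simp [prevA, Letter.p, Letter.q, Letter.r, Letter.c, Letter.d, Letter.a, Letter.b]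
    · erw [deg1]; simp [Letter.p, Letter.q, Letter.r, Letter.c, Letter.d, Letter.a, Letter.b]
    · erw [deg2]; simp [prevB, Letter.p, Letter.q, Letter.r, Letter.c, Letter.d, Letter.a, Letter.b]
    · erw [deg3]; simp [Letter.p, Letter.q, Letter.r, Letter.c, Letter.d, Letter.a, Letter.b]
  · cases x
    · rw [degu]; simp [Letter.p, Letter.q, Letter.r, Letter.c, Letter.d, Letter.a, Letter.b]
    · simp at hv

lemma degG_u' : ((G't t).neighborSet (Sum.inr true)).ncard = 2 * (t + 1) + 3 := by
  rw [G't_eq_encF, degu']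
  simp [Letter.p, Letter.q, Letter.r, Letter.c, Letter.d, Letter.a, Letter.b]; ring

end Encoding2

section Automaton

abbrev St : Type := Bool × Bool × Bool

/-- One step of the layer automaton. -/
def stepD (D : Fin 4 → ℕ → Bool) (st : St) (l : Letter) : Option St :=
  if D 0 (st.1.toNat + l.p.toNat + l.a.toNat) && D 1 (l.p.toNat + l.q.toNat + l.c.toNat) &&
    D 2 (st.2.1.toNat + l.q.toNat + l.r.toNat) && D 3 (l.r.toNat + l.d.toNat + l.b.toNat) &&
    Nat.ble (st.2.2.toNat + (l.c.toNat + l.d.toNat)) 1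
  then some (l.a, l.b, st.2.2 || l.c || l.d) else none

def runD (D : ℕ → Fin 4 → ℕ → Bool) (e g : Bool) (w : ℕ → Letter) : ℕ → Option St
  | 0 => if e && g then none else some (e, g, e || g)
  | n + 1 => (runD D e g w n).bind (fun st => stepD (D n) st (w n))

def pA (e : Bool) (w : ℕ → Letter) : ℕ → Bool
  | 0 => e
  | n + 1 => (w n).a

def pB (g : Bool) (w : ℕ → Letter) : ℕ → Bool
  | 0 => g
  | n + 1 => (w n).b

def lay (D : ℕ → Fin 4 → ℕ → Bool) (e g : Bool) (w : ℕ → Letter) (s : ℕ) : Prop :=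
  D s 0 ((pA e w s).toNat + (w s).p.toNat + (w s).a.toNat) = true ∧
  D s 1 ((w s).p.toNat + (w s).q.toNat + (w s).c.toNat) = true ∧
  D s 2 ((pB g w s).toNat + (w s).q.toNat + (w s).r.toNat) = true ∧
  D s 3 ((w s).r.toNat + (w s).d.toNat + (w s).b.toNat) = true

lemma step_iff (D : Fin 4 → ℕ → Bool) (st : St) (l : Letter) (a b k : Bool) :
    stepD D st l = some (a, b, k) ↔
    ((D 0 (st.1.toNat + l.p.toNat + l.a.toNat) = true ∧
      D 1 (l.p.toNat + l.q.toNat + l.c.toNat) = true ∧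
      D 2 (st.2.1.toNat + l.q.toNat + l.r.toNat) = true ∧
      D 3 (l.r.toNat + l.d.toNat + l.b.toNat) = true) ∧
      a = l.a ∧ b = l.b ∧ k.toNat = st.2.2.toNat + (l.c.toNat + l.d.toNat)) := by
  unfold stepD
  have key : ∀ k0 c d k : Bool, (Nat.ble (k0.toNat + (c.toNat + d.toNat)) 1 = true ∧
      (k0 || c || d) = k) ↔ k.toNat = k0.toNat + (c.toNat + d.toNat) := by decide
  rw [← key]
  split
  · next h =>
    simp only [Bool.and_eq_true] at h
    simp only [Option.some.injEq, Prod.mk.injEq]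
    constructor
    · rintro ⟨h1, h2, h3⟩
      exact ⟨⟨h.1.1.1.1, h.1.1.1.2, h.1.1.2, h.1.2⟩, h1.symm, h2.symm, h.2, h3⟩
    · rintro ⟨-, h1, h2, h3⟩
      exact ⟨h1.symm, h2.symm, h3.2⟩
  · next h =>
    simp only [Bool.and_eq_true] at h
    simp only [reduceCtorEq, false_iff]
    rintro ⟨⟨h1, h2, h3, h4⟩, -, -, h5, -⟩
    exact h ⟨⟨⟨⟨h1, h2⟩, h3⟩, h4⟩, h5⟩

lemma run_iff (D : ℕ → Fin 4 → ℕ → Bool) (e g : Bool) (w : ℕ → Letter) (n : ℕ) (a b k : Bool) :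
    runD D e g w n = some (a, b, k) ↔
      (∀ s < n, lay D e g w s) ∧ a = pA e w n ∧ b = pB g w n ∧
        k.toNat = e.toNat + g.toNat + ∑ s ∈ Finset.range n, ((w s).c.toNat + (w s).d.toNat) := by
  induction n generalizing a b k with
  | zero =>
    simp [runD, pA, pB]
    cases e <;> cases g <;> cases a <;> cases b <;> cases k <;> decide
  | succ n ih =>
    rw [runD, Option.bind_eq_some_iff]
    constructor
    · rintro ⟨⟨a0, b0, k0⟩, h1, h2⟩
      rw [ih] at h1
      rw [step_iff] at h2
      obtain ⟨h3, rfl, rfl, h4⟩ := h1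
      refine ⟨?_, h2.2.1, h2.2.2.1, ?_⟩
      · intro s hs
        rcases Nat.lt_succ_iff_lt_or_eq.1 hs with h | rfl
        · exact h3 s h
        · exact h2.1
      · rw [Finset.sum_range_succ, h2.2.2.2, h4]; ring
    · rintro ⟨h1, rfl, rfl, h4⟩
      rw [Finset.sum_range_succ] at h4
      have hk : k.toNat ≤ 1 := by cases k <;> simp
      have : ∃ k0 : Bool, k0.toNat = e.toNat + g.toNat +
          ∑ s ∈ Finset.range n, ((w s).c.toNat + (w s).d.toNat) := by
        have : e.toNat + g.toNat +
          ∑ s ∈ Finset.range n, ((w s).c.toNat + (w s).d.toNat) = 0 ∨ e.toNat + g.toNat +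
          ∑ s ∈ Finset.range n, ((w s).c.toNat + (w s).d.toNat) = 1 := by omega
        rcases this with h | h
        · exact ⟨false, by rw [h]; rfl⟩
        · exact ⟨true, by rw [h]; rfl⟩
      obtain ⟨k0, hk0⟩ := this
      refine ⟨(pA e w n, pB g w n, k0), ?_, ?_⟩
      · rw [ih]
        exact ⟨fun s hs => h1 s (by omega), rfl, rfl, hk0⟩
      · rw [step_iff]
        refine ⟨h1 n (by omega), rfl, rfl, ?_⟩
        show k.toNat = k0.toNat + _
        omega

lemma run_enc (t : ℕ) (D : ℕ → Fin 4 → ℕ → Bool) (e g h : Bool) (w : ℕ → Letter) (a b k : Bool) :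
    runD D e g w (t + 1) = some (a, b, k) ↔
      (∀ (s : Fin (t + 1)) (j : Fin 4),
        D s j ((encF t e g h (fun s => w s)).neighborSet (Sum.inl (s, j))).ncard = true) ∧
      a = (w t).a ∧ b = (w t).b ∧
      ((encF t e g h (fun s => w s)).neighborSet (Sum.inr true)).ncard = k.toNat + h.toNat := by
  rw [run_iff, degu']
  have hA : ∀ s : Fin (t + 1), prevA e (fun s : Fin (t + 1) => w s) s = pA e w s := by
    rintro ⟨s, hs⟩
    cases s <;> simp [prevA, pA]
  have hB : ∀ s : Fin (t + 1), prevB g (fun s : Fin (t + 1) => w s) s = pB g w s := by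
    rintro ⟨s, hs⟩
    cases s <;> simp [prevB, pB]
  rw [Fin.sum_univ_eq_sum_range (fun s => (w s).c.toNat + (w s).d.toNat) (t + 1)]
  refine and_congr ?_ (and_congr Iff.rfl (and_congr Iff.rfl (by omega)))
  constructor
  · intro H s j
    have := H s s.2
    unfold lay at this
    rw [← hA, ← hB] at this
    fin_cases j
    · erw [deg0]; exact this.1
    · erw [deg1]; exact this.2.1
    · erw [deg2]; exact this.2.2.1
    · erw [deg3]; exact this.2.2.2
  · intro H s hs
    have h0 := H ⟨s, hs⟩ 0
    have h1 := H ⟨s, hs⟩ 1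
    have h2 := H ⟨s, hs⟩ 2
    have h3 := H ⟨s, hs⟩ 3
    rw [deg0, hA] at h0
    rw [deg1] at h1
    rw [deg2, hB] at h2
    rw [deg3] at h3
    exact ⟨h0, h1, h2, h3⟩

lemma run_congr (D : ℕ → Fin 4 → ℕ → Bool) (e g : Bool) (w w' : ℕ → Letter) (n : ℕ)
    (h : ∀ s < n, w s = w' s) : runD D e g w n = runD D e g w' n := by
  induction n with
  | zero => rfl
  | succ n ih =>
    rw [runD, runD, ih (fun s hs => h s (by omega)), h n (by omega)]

end Automaton

section Deletion

def Dd (v : Fin 4 → Bool) (j : Fin 4) (d : ℕ) : Bool := d == (!(v j)).toNat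

def vcount (v : Fin 4 → Bool) : ℕ := (v 0).toNat + (v 1).toNat + (v 2).toNat + (v 3).toNat

/-- Families of simultaneously reachable states after deleting `m` layer vertices. -/
def goods : ℕ → List (List St)
  | 0 => [[(false, false, false), (false, true, true), (true, false, true)]]
  | 1 => [[(false, false, true), (true, false, false)], [(false, false, true), (false, true, false)]]
  | _ => [[(false, false, false)], [(true, false, true)], [(false, true, true)]]

def goods' : ℕ → List (List St)
  | 0 => [[(false, false, false)]]
  | _ => [[(true, false, false)], [(false, true, false)]]

def succB (v : Fin 4 → Bool) (st st' : St) : Bool :=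
  decide (∃ l : Letter, stepD (Dd v) st l = some st')

lemma goods_step : ∀ v : Fin 4 → Bool, ∀ m < 3, vcount v + m ≤ 2 → ∀ X ∈ goods m,
    ∃ Y ∈ goods (m + vcount v), ∀ st' ∈ Y, ∃ st ∈ X, succB v st st' = true := by
  have key : ∀ v : Fin 4 → Bool, ∀ m < 3, vcount v + m ≤ 2 →
      ((goods m).all fun X => (goods (m + vcount v)).any fun Y => Y.all fun st' =>
        X.any fun st => succB v st st') = true := by
    decide +kernel
  intro v m hm hv
  have := key v m hm hv
  simpa only [List.all_eq_true, List.any_eq_true] using this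

lemma goods'_step : ∀ v : Fin 4 → Bool, ∀ m < 2, vcount v + m ≤ 1 → ∀ X ∈ goods' m,
    ∃ Y ∈ goods' (m + vcount v), ∀ st' ∈ Y, ∃ st ∈ X, succB v st st' = true := by
  have key : ∀ v : Fin 4 → Bool, ∀ m < 2, vcount v + m ≤ 1 →
      ((goods' m).all fun X => (goods' (m + vcount v)).any fun Y => Y.all fun st' =>
        X.any fun st => succB v st st') = true := by
    decide +kernel
  intro v m hm hv
  have := key v m hm hv
  simpa only [List.all_eq_true, List.any_eq_true] using this

def Reach (D : ℕ → Fin 4 → ℕ → Bool) (n : ℕ) (st : St) : Prop :=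
  ∃ e g w, runD D e g w n = some st

lemma Reach.step {D : ℕ → Fin 4 → ℕ → Bool} {n : ℕ} {st st' : St} (h : Reach D n st)
    (l : Letter) (hl : stepD (D n) st l = some st') : Reach D (n + 1) st' := by
  obtain ⟨e, g, w, hw⟩ := h
  refine ⟨e, g, Function.update w n l, ?_⟩
  rw [runD, run_congr D e g _ w n, hw]
  · simpa using hl
  · intro s hs
    rw [Function.update_of_ne (by omega)]

lemma reach_goods (del : ℕ → Fin 4 → Bool) (n : ℕ)
    (hn : ∑ s ∈ Finset.range n, vcount (del s) ≤ 2) :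
    ∃ X ∈ goods (∑ s ∈ Finset.range n, vcount (del s)),
      ∀ st ∈ X, Reach (fun s => Dd (del s)) n st := by
  induction n with
  | zero =>
    refine ⟨_, List.mem_singleton.2 rfl, ?_⟩
    intro st hst
    simp only [List.mem_cons, List.not_mem_nil, or_false] at hst
    rcases hst with rfl | rfl | rfl
    · exact ⟨false, false, fun _ => allT, rfl⟩
    · exact ⟨false, true, fun _ => allT, rfl⟩
    · exact ⟨true, false, fun _ => allT, rfl⟩
  | succ n ih =>
    rw [Finset.sum_range_succ] at hn ⊢
    obtain ⟨X, hX, hr⟩ := ih (by omega)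
    obtain ⟨Y, hY, hs⟩ := goods_step (del n) _ (by omega) (by omega) X hX
    refine ⟨Y, hY, fun st' h' => ?_⟩
    obtain ⟨st, h1, h3⟩ := hs st' h'
    obtain ⟨l, h2⟩ := of_decide_eq_true h3
    exact (hr st h1).step l h2

lemma reach_goods' (del : ℕ → Fin 4 → Bool) (n : ℕ)
    (hn : ∑ s ∈ Finset.range n, vcount (del s) ≤ 1) :
    ∃ X ∈ goods' (∑ s ∈ Finset.range n, vcount (del s)),
      ∀ st ∈ X, Reach (fun s => Dd (del s)) n st := by
  induction n with
  | zero =>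
    refine ⟨_, List.mem_singleton.2 rfl, ?_⟩
    intro st hst
    simp only [List.mem_cons, List.not_mem_nil, or_false] at hst
    rcases hst with rfl
    exact ⟨false, false, fun _ => allT, rfl⟩
  | succ n ih =>
    rw [Finset.sum_range_succ] at hn ⊢
    obtain ⟨X, hX, hr⟩ := ih (by omega)
    obtain ⟨Y, hY, hs⟩ := goods'_step (del n) _ (by omega) (by omega) X hX
    refine ⟨Y, hY, fun st' h' => ?_⟩
    obtain ⟨st, h1, h3⟩ := hs st' h'
    obtain ⟨l, h2⟩ := of_decide_eq_true h3
    exact (hr st h1).step l h2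

lemma reach_final {t : ℕ} {del : ℕ → Fin 4 → Bool} {du du' : Bool} {a b k : Bool}
    (hr : Reach (fun s => Dd (del s)) (t + 1) (a, b, k)) (h : Bool)
    (h1 : a.toNat + b.toNat + h.toNat = (!du).toNat) (h2 : k.toNat + h.toNat = (!du').toNat) :
    ∃ F ≤ G't t, (∀ (s : Fin (t + 1)) (j : Fin 4),
        (F.neighborSet (Sum.inl (s, j))).ncard = (!(del s j)).toNat) ∧
      (F.neighborSet (Sum.inr false)).ncard = (!du).toNat ∧
      (F.neighborSet (Sum.inr true)).ncard = (!du').toNat := by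
  obtain ⟨e, g, w, hw⟩ := hr
  rw [run_enc t _ e g h] at hw
  obtain ⟨h3, rfl, rfl, h4⟩ := hw
  refine ⟨_, encF_le e g h (fun s => w s), ?_, ?_, ?_⟩
  · intro s j
    simpa [Dd] using h3 s j
  · rw [degu, ← h1]; simp
  · rw [h4, h2]

lemma del_exists (t : ℕ) (del : ℕ → Fin 4 → Bool) (du du' : Bool)
    (hn : ∑ s ∈ Finset.range (t + 1), vcount (del s) + du.toNat + du'.toNat = 2) :
    ∃ F ≤ G't t, (∀ (s : Fin (t + 1)) (j : Fin 4),
        (F.neighborSet (Sum.inl (s, j))).ncard = (!(del s j)).toNat) ∧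
      (F.neighborSet (Sum.inr false)).ncard = (!du).toNat ∧
      (F.neighborSet (Sum.inr true)).ncard = (!du').toNat := by
  cases du' <;> cases du <;> simp only [Bool.toNat_true, Bool.toNat_false] at hn
  · obtain ⟨X, hX, hr⟩ := reach_goods del (t + 1) (by omega)
    have : ∑ s ∈ Finset.range (t + 1), vcount (del s) = 2 := by omega
    rw [this] at hX
    simp only [goods, List.mem_cons, List.not_mem_nil, or_false] at hX
    rcases hX with rfl | rfl | rfl
    · exact reach_final (hr _ (List.mem_singleton.2 rfl)) true rfl rfl
    · exact reach_final (hr _ (List.mem_singleton.2 rfl)) false rfl rfl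
    · exact reach_final (hr _ (List.mem_singleton.2 rfl)) false rfl rfl
  · obtain ⟨X, hX, hr⟩ := reach_goods del (t + 1) (by omega)
    have : ∑ s ∈ Finset.range (t + 1), vcount (del s) = 1 := by omega
    rw [this] at hX
    simp only [goods, List.mem_cons, List.not_mem_nil, or_false] at hX
    rcases hX with rfl | rfl
    · exact reach_final (hr (false, false, true) (by simp)) false rfl rfl
    · exact reach_final (hr (false, false, true) (by simp)) false rfl rfl
  · obtain ⟨X, hX, hr⟩ := reach_goods' del (t + 1) (by omega)
    have : ∑ s ∈ Finset.range (t + 1), vcount (del s) = 1 := by omega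
    rw [this] at hX
    simp only [goods', List.mem_cons, List.not_mem_nil, or_false] at hX
    rcases hX with rfl | rfl
    · exact reach_final (hr _ (List.mem_singleton.2 rfl)) false rfl rfl
    · exact reach_final (hr _ (List.mem_singleton.2 rfl)) false rfl rfl
  · obtain ⟨X, hX, hr⟩ := reach_goods' del (t + 1) (by omega)
    have : ∑ s ∈ Finset.range (t + 1), vcount (del s) = 0 := by omega
    rw [this] at hX
    simp only [goods', List.mem_cons, List.not_mem_nil, or_false] at hX
    rcases hX with rfl
    exact reach_final (hr _ (List.mem_singleton.2 rfl)) false rfl rfl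

lemma exu_iff {W : Type*} (F : SimpleGraph W) (v : W) :
    (∃! w, F.Adj v w) ↔ (F.neighborSet v).ncard = 1 := by
  rw [Set.ncard_eq_one]
  constructor
  · rintro ⟨w, h1, h2⟩
    refine ⟨w, ?_⟩
    ext z
    exact ⟨fun h => h2 z h, fun h => by rw [Set.mem_singleton_iff] at h; subst h; exact h1⟩
  · rintro ⟨w, h⟩
    have h' : ∀ z, F.Adj v z ↔ z = w := fun z => by
      rw [← SimpleGraph.mem_neighborSet, h, Set.mem_singleton_iff]
    exact ⟨w, (h' w).2 rfl, fun z hz => (h' z).1 hz⟩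

lemma bicF_G't (t : ℕ) : BicF (G't t) := by
  classical
  intro x y hxy
  let P : VT t → Bool := fun v => decide (v = x ∨ v = y)
  let del : ℕ → Fin 4 → Bool := fun s j =>
    if h : s < t + 1 then P (Sum.inl (⟨s, h⟩, j)) else false
  have hdel : ∀ (s : Fin (t + 1)) j, del s j = P (Sum.inl (s, j)) := by
    intro s j; exact dif_pos s.2
  have hsum : ∑ v : VT t, (P v).toNat = 2 := by
    have : ∀ v, (P v).toNat = if v ∈ ({x, y} : Finset (VT t)) then 1 else 0 := by
      intro v
      by_cases h : v = x ∨ v = y <;> simp [P, h]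
      exact not_or.1 h
    rw [Finset.sum_congr rfl (fun v _ => this v), Finset.sum_boole]
    rw [Finset.filter_mem_eq_inter, Finset.univ_inter, Finset.card_pair hxy]; rfl
  obtain ⟨F, hF, h1, h2, h3⟩ := del_exists t del (P (Sum.inr false)) (P (Sum.inr true)) (by
    rw [Fintype.sum_sum_type, Fintype.sum_prod_type, Fintype.sum_bool] at hsum
    rw [← Fin.sum_univ_eq_sum_range (fun s => vcount (del s)) (t + 1)]
    simp only [vcount, hdel]
    simp only [Fin.sum_univ_four] at hsum
    omega)
  have hall : ∀ v, (F.neighborSet v).ncard = (!(P v)).toNat := by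
    rintro (⟨s, j⟩ | x)
    · rw [h1, hdel]
    · cases x
      · exact h2
      · exact h3
  have h0 : ∀ v, P v = true → ∀ w, ¬ F.Adj v w := by
    intro v hv w hw
    have := hall v
    rw [hv, Bool.not_true, Bool.toNat_false, Set.ncard_eq_zero] at this
    have hw' : w ∈ F.neighborSet v := hw
    rw [this] at hw'
    exact hw'
  refine ⟨F, hF, h0 x (by simp [P]), h0 y (by simp [P]), ?_⟩
  intro v hx hy
  rw [exu_iff, hall]
  simp [P, hx, hy]

end Deletion

section Counting

def extW {n : ℕ} (w : Fin n → Letter) (s : ℕ) : Letter :=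
  if h : s < n then w ⟨s, h⟩ else allT

/-- Number of assignments of the first `n` layers leading to a given automaton state. -/
def cntD (D : ℕ → Fin 4 → ℕ → Bool) (n : ℕ) (o : Option St) : ℕ :=
  ∑ e : Bool, ∑ g : Bool, ∑ w : Fin n → Letter, if runD D e g (extW w) n = o then 1 else 0

def trD (D : Fin 4 → ℕ → Bool) (st : St) (o : Option St) : ℕ :=
  ∑ l : Letter, if stepD D st l = o then 1 else 0

lemma sum_via {X O : Type*} [Fintype X] [Fintype O] [DecidableEq O] (r : X → O) (f : O → ℕ) :
    ∑ x, f (r x) = ∑ o, (∑ x, if r x = o then 1 else 0) * f o := by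
  simp_rw [Finset.sum_mul]
  rw [Finset.sum_comm]
  refine Finset.sum_congr rfl fun x _ => ?_
  simp

lemma cnt_via (D : ℕ → Fin 4 → ℕ → Bool) (n : ℕ) (f : Option St → ℕ) :
    ∑ e : Bool, ∑ g : Bool, ∑ w : Fin n → Letter, f (runD D e g (extW w) n) =
      ∑ o, cntD D n o * f o := by
  have := sum_via (fun x : Bool × Bool × (Fin n → Letter) => runD D x.1 x.2.1 (extW x.2.2) n) f
  simp only [Fintype.sum_prod_type] at this
  exact this

lemma cnt_succ (D : ℕ → Fin 4 → ℕ → Bool) (n : ℕ) (st' : St) :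
    cntD D (n + 1) (some st') = ∑ st : St, cntD D n (some st) * trD (D n) st (some st') := by
  have h1 : cntD D (n + 1) (some st') = ∑ e : Bool, ∑ g : Bool, ∑ w : Fin n → Letter,
      ∑ l : Letter, if (runD D e g (extW w) n).bind (fun st => stepD (D n) st l) = some st'
        then 1 else 0 := by
    unfold cntD
    refine Finset.sum_congr rfl fun e _ => Finset.sum_congr rfl fun g _ => ?_
    rw [← (Fin.snocEquiv (fun _ : Fin (n + 1) => Letter)).sum_comp, Fintype.sum_prod_type,
      Finset.sum_comm]
    refine Finset.sum_congr rfl fun w _ => Finset.sum_congr rfl fun l _ => ?_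
    have h2 : extW (Fin.snocEquiv (fun _ : Fin (n + 1) => Letter) (l, w)) n = l := by
      have : (⟨n, by omega⟩ : Fin (n + 1)) = Fin.last n := rfl
      simp [extW, Fin.snocEquiv, this]
    have h3 : ∀ s < n, extW (Fin.snocEquiv (fun _ : Fin (n + 1) => Letter) (l, w)) s =
        extW w s := by
      intro s hs
      have : (⟨s, by omega⟩ : Fin (n + 1)) = Fin.castSucc ⟨s, hs⟩ := rfl
      simp only [extW, Fin.snocEquiv, dif_pos hs, dif_pos (show s < n + 1 by omega)]
      rw [this]
      exact Fin.snoc_castSucc (α := fun _ => Letter) l w ⟨s, hs⟩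
    rw [runD, h2, run_congr D e g _ (extW w) n h3]
  rw [h1]
  have h4 := cnt_via D n (fun o => ∑ l : Letter, if o.bind (fun st => stepD (D n) st l) = some st'
        then 1 else 0)
  rw [h4, Fintype.sum_option]
  simp [trD]

/-- Allowed degrees: one, or three at flagged vertices. -/
def Df (z f1 f3 : Bool) (j : Fin 4) (d : ℕ) : Bool :=
  d == 1 || (d == 3 && (![z, f1, z, f3] j))

lemma tr_zero : ∀ z f1 f3 : Bool, ∀ st st' : St,
    ((xor (xor st.1 st.2.1) st.2.2 ≠ xor (xor st'.1 st'.2.1) st'.2.2) ∨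
     (st.2.2 = true ∧ st'.2.2 = false)) → trD (Df z f1 f3) st (some st') = 0 := by
  decide +kernel

lemma tr_facts : ∀ f1 f3 : Bool,
   (trD (Df false f1 f3) (false, false, false) (some (false, false, false)) +
    trD (Df false f1 f3) (true, true, false) (some (false, false, false)) = 1 ∧
   trD (Df false f1 f3) (false, false, false) (some (true, true, false)) +
    trD (Df false f1 f3) (true, true, false) (some (true, true, false)) = 1) ∧
   trD (Df false f1 f3) (false, false, false) (some (true, false, true)) +
   trD (Df false f1 f3) (true, true, false) (some (true, false, true)) +
   trD (Df false f1 f3) (false, false, false) (some (false, true, true)) +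
   trD (Df false f1 f3) (true, true, false) (some (false, true, true)) =
     3 + f1.toNat + f3.toNat := by
  decide +kernel

lemma tr_facts_one : ∀ f1 f3 : Bool,
   trD (Df false f1 f3) (true, false, true) (some (true, false, true)) +
   trD (Df false f1 f3) (true, false, true) (some (false, true, true)) = 1 ∧
   trD (Df false f1 f3) (false, true, true) (some (true, false, true)) +
   trD (Df false f1 f3) (false, true, true) (some (false, true, true)) = 1 := by
  decide +kernel

lemma tr_facts_base : ∀ f1 f3 : Bool,
   trD (Df true f1 f3) (false, false, false) (some (false, false, false)) = 1 ∧
   trD (Df true f1 f3) (false, false, false) (some (true, true, false)) = 1 ∧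
   trD (Df true f1 f3) (false, false, false) (some (true, false, true)) +
   trD (Df true f1 f3) (false, false, false) (some (false, true, true)) +
   (trD (Df true f1 f3) (true, false, true) (some (true, false, true)) +
   trD (Df true f1 f3) (true, false, true) (some (false, true, true))) +
   (trD (Df true f1 f3) (false, true, true) (some (true, false, true)) +
   trD (Df true f1 f3) (false, true, true) (some (false, true, true))) =
     6 + f1.toNat + f3.toNat := by
  decide +kernel

lemma cnt_init (D : ℕ → Fin 4 → ℕ → Bool) (st : St) : cntD D 0 (some st) =
    if st = (false, false, false) ∨ st = (true, false, true) ∨ st = (false, true, true)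
      then 1 else 0 := by
  simp only [cntD, runD, Fintype.sum_bool, Fintype.sum_unique]
  obtain ⟨a, b, k⟩ := st
  cases a <;> cases b <;> cases k <;> simp

structure CntInv (N : St → ℕ) (m : ℕ) : Prop where
  z1 : N (false, false, true) = 0
  z2 : N (false, true, false) = 0
  z3 : N (true, false, false) = 0
  z4 : N (true, true, true) = 0
  o1 : N (false, false, false) = 1
  o2 : N (true, true, false) = 1
  o3 : N (true, false, true) + N (false, true, true) = m

lemma sum_St (f : St → ℕ) : ∑ st, f st = f (false, false, false) + f (false, false, true) +
    f (false, true, false) + f (false, true, true) + f (true, false, false) +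
    f (true, false, true) + f (true, true, false) + f (true, true, true) := by
  simp only [Fintype.sum_prod_type, Fintype.sum_bool]
  ring

lemma cnt_inv (f1 f3 : ℕ → Bool) (n : ℕ) :
    CntInv (fun st => cntD (fun s => Df (s == 0) (f1 s) (f3 s)) (n + 1) (some st))
      (3 * (n + 1) + 1 + (2 + ∑ s ∈ Finset.range (n + 1), ((f1 s).toNat + (f3 s).toNat))) := by
  induction n with
  | zero =>
    obtain ⟨b1, b2, b3⟩ := tr_facts_base (f1 0) (f3 0)
    have tz := tr_zero true (f1 0) (f3 0)
    constructor <;>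
    · simp only [cnt_succ, sum_St, cnt_init]
      simp (disch := decide) [tz]
      try omega
  | succ n ih =>
    obtain ⟨z1, z2, z3, z4, o1, o2, o3⟩ := ih
    obtain ⟨⟨b1, b2⟩, b3⟩ := tr_facts (f1 (n + 1)) (f3 (n + 1))
    obtain ⟨c1, c2⟩ := tr_facts_one (f1 (n + 1)) (f3 (n + 1))
    have tz := tr_zero false (f1 (n + 1)) (f3 (n + 1))
    have hD : (n + 1 == 0) = false := rfl
    constructor
    all_goals
      simp only [cnt_succ _ (n + 1), sum_St, z1, z2, z3, z4, o1, o2, hD]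
      simp (disch := decide) only [tz, zero_mul, mul_zero, one_mul, add_zero, zero_add]
    · exact b1
    · exact b2
    · rw [Finset.sum_range_succ]
      nlinarith [congrArg (cntD (fun s => Df (s == 0) (f1 s) (f3 s)) (n + 1) (some (true, false, true)) * ·) c1, congrArg (cntD (fun s => Df (s == 0) (f1 s) (f3 s)) (n + 1) (some (false, true, true)) * ·) c2]

end Counting

section FinalCount

def finOK (h fu : Bool) : Option St → Bool
  | none => false
  | some (a, b, k) => (a.toNat + b.toNat + h.toNat == 1 ||
      (fu && a.toNat + b.toNat + h.toNat == 3)) && k.toNat + h.toNat == 1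

variable {t : ℕ} {S' : Set (VT t)}

lemma full_iff {W : Type*} [Fintype W] {F G : SimpleGraph W} (hF : F ≤ G) (v : W)
    (hv : (G.neighborSet v).ncard = 3) :
    (∀ w, G.Adj v w → F.Adj v w) ↔ (F.neighborSet v).ncard = 3 := by
  have hs : F.neighborSet v ⊆ G.neighborSet v := fun w hw => hF hw
  constructor
  · intro h
    rw [← hv]
    congr 1
    exact hs.antisymm (fun w hw => h w hw)
  · intro h w hw
    have := Set.eq_of_subset_of_ncard_le hs (by rw [h, hv]) (Set.toFinite _)
    have hw' : w ∈ G.neighborSet v := hw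
    rw [← this] at hw'
    exact hw'

lemma mem_ConfSet_iff (hS : Sum.inr true ∉ S') {F : SimpleGraph (VT t)} (hF : F ≤ G't t) :
    F ∈ ConfSet (G't t) S' ↔
      ∀ v, (F.neighborSet v).ncard = 1 ∨ (v ∈ S' ∧ (F.neighborSet v).ncard = 3) := by
  simp only [ConfSet, Set.mem_ofPred_eq, hF, true_and]
  refine forall_congr' fun v => ?_
  rw [exu_iff]
  refine or_congr Iff.rfl (and_congr_right fun hv => ?_)
  exact full_iff hF v (degG_ne v (fun h => hS (h ▸ hv)))

lemma conf_iff (hS : Sum.inr true ∉ S') (f1 f3 : ℕ → Bool) (fu : Bool)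
    (h0 : ∀ s : Fin (t + 1), Sum.inl (s, 0) ∈ S' ↔ ((s : ℕ) == 0) = true)
    (h1 : ∀ s : Fin (t + 1), Sum.inl (s, 1) ∈ S' ↔ f1 s = true)
    (h2 : ∀ s : Fin (t + 1), Sum.inl (s, 2) ∈ S' ↔ ((s : ℕ) == 0) = true)
    (h3 : ∀ s : Fin (t + 1), Sum.inl (s, 3) ∈ S' ↔ f3 s = true)
    (hu : Sum.inr false ∈ S' ↔ fu = true) (e g h : Bool) (w : Fin (t + 1) → Letter) :
    encF t e g h w ∈ ConfSet (G't t) S' ↔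
      finOK h fu (runD (fun s => Df (s == 0) (f1 s) (f3 s)) e g (extW w) (t + 1)) = true := by
  rw [mem_ConfSet_iff hS (encF_le e g h w)]
  have hw : (fun s : Fin (t + 1) => extW w s) = w := by
    funext s; exact dif_pos s.2
  have hlast : extW w t = w (Fin.last t) := by
    simp [extW, Fin.last]
  have hR := fun a b k => run_enc t (fun s => Df (s == 0) (f1 s) (f3 s)) e g h (extW w) a b k
  rw [hw, hlast] at hR
  have hD : ∀ (s : Fin (t + 1)) (j : Fin 4) (d : ℕ),
      Df ((s : ℕ) == 0) (f1 s) (f3 s) j d = true ↔ d = 1 ∨ (Sum.inl (s, j) ∈ S' ∧ d = 3) := by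
    intro s j d
    fin_cases j
    · erw [h0]; simp [Df]; tauto
    · erw [h1]; simp [Df]; tauto
    · erw [h2]; simp [Df]; tauto
    · erw [h3]; simp [Df]; tauto
  simp only [hD] at hR
  constructor
  · intro H
    have Hu' := H (Sum.inr true)
    simp only [hS, false_and, or_false] at Hu'
    have Hu := H (Sum.inr false)
    rw [degu, hu] at Hu
    have hh : ∃ k : Bool, k.toNat + h.toNat = 1 := ⟨!h, by cases h <;> rfl⟩
    obtain ⟨k, hk⟩ := hh
    rw [(hR _ _ k).2 ⟨fun s j => H _, rfl, rfl, by rw [hk, Hu']⟩]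
    simp only [finOK, Bool.and_eq_true, Bool.or_eq_true, beq_iff_eq]
    exact ⟨Hu, hk⟩
  · intro H
    rcases ho : runD (fun s => Df (s == 0) (f1 s) (f3 s)) e g (extW w) (t + 1) with _ | ⟨a, b, k⟩
    · rw [ho] at H; simp [finOK] at H
    · rw [ho] at H
      obtain ⟨r1, r2, r3, r4⟩ := (hR _ _ _).1 ho
      simp only [finOK, Bool.and_eq_true, Bool.or_eq_true, beq_iff_eq] at H
      rintro (⟨s, j⟩ | x)
      · exact r1 s j
      · cases x
        · rw [degu, hu, ← r2, ← r3]; exact H.1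
        · left; rw [r4]; exact H.2

lemma ncard_conf (hS : Sum.inr true ∉ S') (f1 f3 : ℕ → Bool) (fu : Bool)
    (h0 : ∀ s : Fin (t + 1), Sum.inl (s, 0) ∈ S' ↔ ((s : ℕ) == 0) = true)
    (h1 : ∀ s : Fin (t + 1), Sum.inl (s, 1) ∈ S' ↔ f1 s = true)
    (h2 : ∀ s : Fin (t + 1), Sum.inl (s, 2) ∈ S' ↔ ((s : ℕ) == 0) = true)
    (h3 : ∀ s : Fin (t + 1), Sum.inl (s, 3) ∈ S' ↔ f3 s = true)
    (hu : Sum.inr false ∈ S' ↔ fu = true) :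
    (ConfSet (G't t) S').ncard = 3 * (t + 1) + 2 +
      (2 + ∑ s ∈ Finset.range (t + 1), ((f1 s).toNat + (f3 s).toNat) + fu.toNat) := by
  classical
  have e1 : ConfSet (G't t) S' =
      (fun x : Bool × Bool × Bool × (Fin (t + 1) → Letter) => encF t x.2.1 x.2.2.1 x.1 x.2.2.2) ''
      {x | finOK x.1 fu (runD (fun s => Df (s == 0) (f1 s) (f3 s)) x.2.1 x.2.2.1
        (extW x.2.2.2) (t + 1)) = true} := by
    ext F
    constructor
    · intro hF
      have hle : F ≤ G't t := hF.1
      have := encF_rd F hle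
      rw [← this, conf_iff hS f1 f3 fu h0 h1 h2 h3 hu] at hF
      exact ⟨(_, _, _, _), hF, this⟩
    · rintro ⟨x, hx, rfl⟩
      exact (conf_iff hS f1 f3 fu h0 h1 h2 h3 hu _ _ _ _).2 hx
  rw [e1, Set.ncard_image_of_injective]
  swap
  · rintro ⟨h, e, g, w⟩ ⟨h', e', g', w'⟩ H
    obtain ⟨rfl, rfl, rfl, rfl⟩ := encF_inj H
    rfl
  rw [← sum_ind]
  rw [Fintype.sum_prod_type]
  simp only [Fintype.sum_prod_type (α₁ := Bool), Set.mem_ofPred_eq]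
  have key : ∀ h : Bool, _ := fun h => cnt_via (fun s => Df (s == 0) (f1 s) (f3 s)) (t + 1)
    (fun o => if finOK h fu o = true then 1 else 0)
  simp only [key]
  obtain ⟨z1, z2, z3, z4, o1, o2, o3⟩ := cnt_inv f1 f3 t
  simp only [Fintype.sum_bool, Fintype.sum_option, sum_St]
  cases fu <;> simp [finOK, o1, o2] <;> omega

end FinalCount

section ThreeConn

/-- Connected by a path avoiding `s`. -/
def Cn {V : Type*} (G : SimpleGraph V) (s : Set V) (x y : V) : Prop :=
  ∃ (hx : x ∈ sᶜ) (hy : y ∈ sᶜ), (G.induce (sᶜ : Set V)).Reachable ⟨x, hx⟩ ⟨y, hy⟩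

variable {V : Type*} {G : SimpleGraph V} {s : Set V}

lemma Cn.refl {x : V} (hx : x ∉ s) : Cn G s x x := ⟨hx, hx, SimpleGraph.Reachable.refl _⟩

lemma Cn.symm {x y : V} (h : Cn G s x y) : Cn G s y x := ⟨h.2.1, h.1, h.2.2.symm⟩

lemma Cn.trans {x y z : V} (h : Cn G s x y) (h' : Cn G s y z) : Cn G s x z :=
  ⟨h.1, h'.2.1, h.2.2.trans h'.2.2⟩

lemma Cn.adj {x y : V} (h : G.Adj x y) (hx : x ∉ s) (hy : y ∉ s) : Cn G s x y :=
  ⟨hx, hy, SimpleGraph.Adj.reachable (by simpa using h)⟩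

lemma cn_path (f : ℕ → V) (i j : ℕ) (hij : i ≤ j) (hadj : ∀ k, i ≤ k → k < j → G.Adj (f k) (f (k + 1)))
    (hs : ∀ k, i ≤ k → k ≤ j → f k ∉ s) : Cn G s (f i) (f j) := by
  induction j, hij using Nat.le_induction with
  | base => exact Cn.refl (hs i le_rfl le_rfl)
  | succ j hj ih =>
    refine (ih (fun k h1 h2 => hadj k h1 (by omega)) (fun k h1 h2 => hs k h1 (by omega))).trans ?_
    exact Cn.adj (hadj j hj (by omega)) (hs j hj (by omega)) (hs (j + 1) (by omega) le_rfl)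

lemma cn_cycle (f : ℕ → V) (N : ℕ) (hadj : ∀ k, k < N → G.Adj (f k) (f (k + 1)))
    (hend : G.Adj (f N) (f 0)) (z : ℕ) (hz : ∀ k ≤ N, f k ∈ s → k = z)
    {i j : ℕ} (hi : i ≤ N) (hj : j ≤ N) (hfi : f i ∉ s) (hfj : f j ∉ s) : Cn G s (f i) (f j) := by
  wlog hij : i ≤ j generalizing i j
  · exact (this hj hi hfj hfi (by omega)).symm
  by_cases h : i < z ∧ z < j
  · have h1 : Cn G s (f 0) (f i) := cn_path f 0 i (by omega) (fun k _ _ => hadj k (by omega))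
      (fun k _ h2 h3 => by have := hz k (by omega) h3; omega)
    have h2 : Cn G s (f j) (f N) := cn_path f j N (by omega) (fun k _ _ => hadj k (by omega))
      (fun k _ h2 h3 => by have := hz k (by omega) h3; omega)
    exact (h2.trans ((Cn.adj hend h2.2.1 h1.1).trans h1)).symm
  · refine cn_path f i j hij (fun k _ _ => hadj k (by omega)) (fun k h1 h2 h3 => ?_)
    have := hz k (by omega) h3
    have : k ≠ i := fun h => hfi (h ▸ h3)
    have : k ≠ j := fun h => hfj (h ▸ h3)
    omega

lemma three_alive [Finite V] (hs : s.ncard ≤ 2) {a b c : V} (hab : a ≠ b) (hac : a ≠ c) (hbc : b ≠ c) :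
    a ∉ s ∨ b ∉ s ∨ c ∉ s := by
  by_contra! h
  have : ({a, b, c} : Set V) ⊆ s := by
    rintro x (rfl | rfl | rfl)
    exacts [h.1, h.2.1, h.2.2]
  have h1 := Set.ncard_le_ncard this (Set.toFinite _)
  rw [Set.ncard_eq_three.2 ⟨a, b, c, hab, hac, hbc, rfl⟩] at h1
  omega

variable {t : ℕ}

def vx (t i : ℕ) (j : Fin 4) : VT t :=
  if h : i < t + 1 then Sum.inl (⟨i, h⟩, j) else Sum.inr false

lemma adj_path (i : ℕ) (hi : i < t + 1) (j j' : Fin 4) (h : (j' : ℕ) = j + 1) :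
    (G't t).Adj (vx t i j) (vx t i j') := by
  rw [G't, SimpleGraph.fromRel_adj]
  simp only [vx, dif_pos hi]
  refine ⟨?_, Or.inl (Or.inl ⟨_, _, _, h, rfl, rfl⟩)⟩
  intro h'
  simp only [Sum.inl.injEq, Prod.mk.injEq, true_and] at h'
  subst h'; omega

lemma adj_top (i : ℕ) (hi : i < t + 1) : (G't t).Adj (vx t i 0) (vx t (i + 1) 0) := by
  rw [G't, SimpleGraph.fromRel_adj]
  by_cases h : i + 1 < t + 1
  · simp only [vx, dif_pos hi, dif_pos h]
    refine ⟨by simp, Or.inl (Or.inr (Or.inl ⟨⟨i, hi⟩, ⟨i + 1, h⟩, rfl, Or.inl ⟨rfl, rfl⟩⟩))⟩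
  · have : i = t := by omega
    subst this
    rw [vx, vx, dif_pos hi, dif_neg h]
    exact ⟨by simp, Or.inl (Or.inr (Or.inr (Or.inl ⟨rfl, rfl⟩)))⟩

lemma adj_bot (i : ℕ) (hi : i < t + 1) : (G't t).Adj (vx t i 3) (vx t (i + 1) 2) := by
  rw [G't, SimpleGraph.fromRel_adj]
  by_cases h : i + 1 < t + 1
  · simp only [vx, dif_pos hi, dif_pos h]
    refine ⟨by simp, Or.inl (Or.inr (Or.inl ⟨⟨i, hi⟩, ⟨i + 1, h⟩, rfl, Or.inr ⟨rfl, rfl⟩⟩))⟩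
  · have : i = t := by omega
    subst this
    rw [vx, vx, dif_pos hi, dif_neg h]
    exact ⟨by simp, Or.inl (Or.inr (Or.inr (Or.inr (Or.inl ⟨rfl, rfl⟩))))⟩

lemma adj_spoke (v : VT t) (hv : v ∈ Sset t) : (G't t).Adj v (Sum.inr true) := by
  rw [G't, SimpleGraph.fromRel_adj]
  refine ⟨?_, Or.inl (Or.inr (Or.inr (Or.inr (Or.inr ⟨hv, rfl⟩))))⟩
  rintro rfl
  simp [Sset] at hv

def cyc (t i : ℕ) : VT t :=
  if i ≤ t + 1 then vx t i 0 else if i ≤ 3 * t + 3 then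
    (if (3 * t + 3 - i) % 2 = 0 then vx t ((3 * t + 3 - i) / 2) 2
      else vx t ((3 * t + 3 - i) / 2) 3) else vx t 0 1

lemma cyc_adj (k : ℕ) (hk : k < 3 * t + 4) : (G't t).Adj (cyc t k) (cyc t (k + 1)) := by
  unfold cyc
  by_cases h1 : k + 1 ≤ t + 1
  · rw [if_pos (by omega), if_pos h1]
    exact adj_top k (by omega)
  by_cases h2 : k = t + 1
  · subst h2
    rw [if_pos (by omega), if_neg (by omega), if_pos (by omega), if_neg (by omega)]
    have := (adj_bot (t := t) t (by omega)).symm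
    rw [show (3 * t + 3 - (t + 1 + 1)) / 2 = t by omega]
    simpa [vx] using this
  by_cases h3 : k = 3 * t + 3
  · subst h3
    rw [if_neg (by omega), if_pos (by omega), if_pos (by omega), if_neg (by omega),
      if_neg (by omega)]
    rw [show (3 * t + 3 - (3 * t + 3)) / 2 = 0 by omega]
    exact (adj_path 0 (by omega) 1 2 rfl).symm
  rw [if_neg (show ¬ k ≤ t + 1 by omega), if_pos (show k ≤ 3 * t + 3 by omega),
    if_neg (show ¬ k + 1 ≤ t + 1 by omega), if_pos (show k + 1 ≤ 3 * t + 3 by omega)]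
  by_cases h4 : (3 * t + 3 - k) % 2 = 0
  · rw [if_pos h4, if_neg (by omega)]
    obtain ⟨m, hm⟩ : ∃ m, 3 * t + 3 - k = 2 * (m + 1) := ⟨(3 * t + 3 - k) / 2 - 1, by omega⟩
    rw [show (3 * t + 3 - k) / 2 = m + 1 by omega, show (3 * t + 3 - (k + 1)) / 2 = m by omega]
    exact (adj_bot m (by omega)).symm
  · rw [if_neg h4, if_pos (by omega)]
    rw [show (3 * t + 3 - (k + 1)) / 2 = (3 * t + 3 - k) / 2 by omega]
    exact (adj_path _ (by omega) 2 3 rfl).symm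

lemma cyc_end : (G't t).Adj (cyc t (3 * t + 4)) (cyc t 0) := by
  unfold cyc
  rw [if_neg (by omega), if_neg (by omega), if_pos (by omega)]
  exact (adj_path 0 (by omega) 0 1 rfl).symm

/-- Every vertex other than `u'` and the `u_s^2`, `s ≥ 1`, lies on the cycle. -/
lemma cyc_surj (v : VT t) (h1 : v ≠ Sum.inr true)
    (h2 : ∀ i : Fin (t + 1), (i : ℕ) ≠ 0 → v ≠ Sum.inl (i, 1)) :
    ∃ k ≤ 3 * t + 4, cyc t k = v := by
  rcases v with ⟨⟨i, hi⟩, j⟩ | x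
  · fin_cases j
    · refine ⟨i, by omega, ?_⟩
      simp [cyc, vx, hi, hi.le]
    · have : i = 0 := by
        by_contra h
        exact h2 ⟨i, hi⟩ h rfl
      subst this
      refine ⟨3 * t + 4, by omega, ?_⟩
      unfold cyc
      rw [if_neg (by omega), if_neg (by omega)]
      simp [vx]
    · refine ⟨3 * t + 3 - 2 * i, by omega, ?_⟩
      unfold cyc
      rw [if_neg (by omega), if_pos (by omega), if_pos (by omega),
        show (3 * t + 3 - (3 * t + 3 - 2 * i)) / 2 = i by omega]
      simp [vx, hi]
    · refine ⟨3 * t + 3 - (2 * i + 1), by omega, ?_⟩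
      unfold cyc
      rw [if_neg (by omega), if_pos (by omega), if_neg (by omega),
        show (3 * t + 3 - (3 * t + 3 - (2 * i + 1))) / 2 = i by omega]
      simp [vx, hi]
  · cases x
    · exact ⟨t + 1, by omega, by simp [cyc, vx]⟩
    · simp at h1

lemma cyc_inj {k l : ℕ} (hk : k ≤ 3 * t + 4) (hl : l ≤ 3 * t + 4) (h : cyc t k = cyc t l) :
    k = l := by
  unfold cyc vx at h
  split_ifs at h <;> simp [Fin.ext_iff] at h <;> omega

lemma cyc_ne_u' (k : ℕ) : cyc t k ≠ Sum.inr true := by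
  unfold cyc vx
  split_ifs <;> simp

lemma cyc_ne_off (k : ℕ) (i : Fin (t + 1)) (hi : (i : ℕ) ≠ 0) : cyc t k ≠ Sum.inl (i, 1) := by
  unfold cyc vx
  split_ifs <;> simp [Fin.ext_iff] <;> omega

/-- If some deleted vertex is off the cycle then the rest of the cycle is connected. -/
lemma cyc_conn {s : Set (VT t)} (hs : s.ncard ≤ 2) (p : VT t) (hp : p ∈ s)
    (hoff : ∀ k, cyc t k ≠ p) {x y : VT t} (hx : ∃ k ≤ 3 * t + 4, cyc t k = x)
    (hy : ∃ k ≤ 3 * t + 4, cyc t k = y) (hxs : x ∉ s) (hys : y ∉ s) : Cn (G't t) s x y := by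
  have hz : ∃ z, ∀ k ≤ 3 * t + 4, cyc t k ∈ s → k = z := by
    by_cases h : ∃ z ≤ 3 * t + 4, cyc t z ∈ s
    · obtain ⟨z, hz, hzs⟩ := h
      refine ⟨z, fun k hk hks => ?_⟩
      by_contra hne
      rcases three_alive hs (fun h => hne (cyc_inj hk hz h)) (hoff k) (hoff z) with h | h | h
      exacts [h hks, h hzs, h hp]
    · push Not at h
      exact ⟨0, fun k hk hks => absurd hks (h k hk)⟩
  obtain ⟨z, hz⟩ := hz
  obtain ⟨i, hi, rfl⟩ := hx
  obtain ⟨j, hj, rfl⟩ := hy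
  exact cn_cycle (cyc t) (3 * t + 4) (fun k hk => cyc_adj k hk) cyc_end z hz hi hj hxs hys

lemma adj_path' (i : Fin (t + 1)) (j j' : Fin 4) (h : (j' : ℕ) = j + 1) :
    (G't t).Adj (Sum.inl (i, j)) (Sum.inl (i, j')) := by
  have := adj_path (t := t) i i.2 j j' h
  rw [vx, vx, dif_pos i.2, dif_pos i.2] at this
  exact this

lemma threeConnected_G't : ThreeConnected (G't t) := by
  refine ⟨by simp; omega, fun s hs => ?_⟩
  have main : ∃ r, r ∉ s ∧ ∀ x, x ∉ s → Cn (G't t) s x r := by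
    by_cases hu : Sum.inr true ∈ s
    · -- two alive cycle vertices suffice to find a root
      obtain ⟨r, hr, hrs⟩ : ∃ r, (∃ k ≤ 3 * t + 4, cyc t k = r) ∧ r ∉ s := by
        rcases three_alive hs (a := Sum.inr true) (b := Sum.inr false) (c := Sum.inl (0, 0))
          (by simp) (by simp) (by simp) with h | h | h
        · exact absurd hu h
        · exact ⟨_, cyc_surj _ (by simp) (by simp), h⟩
        · exact ⟨_, cyc_surj _ (by simp) (by simp), h⟩
      refine ⟨r, hrs, fun x hx => ?_⟩
      by_cases hoff : ∃ i : Fin (t + 1), (i : ℕ) ≠ 0 ∧ x = Sum.inl (i, 1)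
      · obtain ⟨i, hi, rfl⟩ := hoff
        rcases three_alive hs (a := Sum.inr true) (b := Sum.inl (i, 0)) (c := Sum.inl (i, 2))
          (by simp) (by simp) (by simp) with h | h | h
        · exact absurd hu h
        · exact (Cn.adj (adj_path' i 0 1 rfl).symm hx h).trans
            (cyc_conn hs _ hu cyc_ne_u' (cyc_surj _ (by simp) (by simp)) hr h hrs)
        · exact (Cn.adj (adj_path' i 1 2 rfl) hx h).trans
            (cyc_conn hs _ hu cyc_ne_u' (cyc_surj _ (by simp) (by simp)) hr h hrs)
      · push Not at hoff
        exact cyc_conn hs _ hu cyc_ne_u' (cyc_surj _ (fun h => hx (h ▸ hu)) hoff) hr hx hrs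
    · refine ⟨Sum.inr true, hu, fun x hx => ?_⟩
      by_cases hxS : x ∈ Sset t
      · exact Cn.adj (adj_spoke x hxS) hx hu
      rcases x with ⟨i, j⟩ | x
      · have hm1 : Sum.inl (i, 1) ∈ Sset t := by simp [Sset]
        have hm3 : ∀ i : Fin (t + 1), Sum.inl (i, 3) ∈ Sset t := by intro i; simp [Sset]
        fin_cases j
        · have hi : (i : ℕ) ≠ 0 := by
            intro h
            have : i = 0 := Fin.ext h
            subst this
            simp [Sset] at hxS
          by_cases h1 : Sum.inl (i, 1) ∈ s
          · obtain ⟨r, hr, hrs, hrS⟩ : ∃ r, (∃ k ≤ 3 * t + 4, cyc t k = r) ∧ r ∉ s ∧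
                r ∈ Sset t := by
              rcases three_alive hs (a := Sum.inl (i, 1)) (b := Sum.inr false)
                (c := Sum.inl (0, 0)) (by simp) (by simp) (by simp) with h | h | h
              · exact absurd h1 h
              · exact ⟨_, cyc_surj _ (by simp) (by simp), h, by simp [Sset]⟩
              · exact ⟨_, cyc_surj _ (by simp) (by simp), h, by simp [Sset]⟩
            exact (cyc_conn hs _ h1 (fun k => cyc_ne_off k i hi)
              (cyc_surj _ (by simp) (by simp)) hr hx hrs).trans (Cn.adj (adj_spoke r hrS) hrs hu)
          · exact (Cn.adj (adj_path' i 0 1 rfl) hx h1).trans (Cn.adj (adj_spoke _ hm1) h1 hu)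
        · exact absurd hm1 hxS
        · have hi : (i : ℕ) ≠ 0 := by
            intro h
            have : i = 0 := Fin.ext h
            subst this
            simp [Sset] at hxS
          obtain ⟨i, hi'⟩ := i
          obtain ⟨m, rfl⟩ : ∃ m, i = m + 1 := ⟨i - 1, by simp at hi; omega⟩
          have hb := (adj_bot (t := t) m (by omega)).symm
          simp only [vx, dif_pos hi', dif_pos (show m < t + 1 by omega)] at hb
          rcases three_alive hs (a := Sum.inl (⟨m + 1, hi'⟩, 1)) (b := Sum.inl (⟨m + 1, hi'⟩, 3))
            (c := Sum.inl (⟨m, by omega⟩, 3)) (by simp) (by simp) (by simp) with h | h | h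
          · exact (Cn.adj (adj_path' _ 1 2 rfl).symm hx h).trans (Cn.adj (adj_spoke _ hm1) h hu)
          · exact (Cn.adj (adj_path' _ 2 3 rfl) hx h).trans (Cn.adj (adj_spoke _ (hm3 _)) h hu)
          · exact (Cn.adj hb hx h).trans (Cn.adj (adj_spoke _ (hm3 _)) h hu)
        · exact absurd (hm3 i) hxS
      · cases x
        · simp [Sset] at hxS
        · exact Cn.refl hx
  obtain ⟨r, hr, H⟩ := main
  haveI : Nonempty (sᶜ : Set (VT t)) := ⟨⟨r, hr⟩⟩
  refine SimpleGraph.Connected.mk ?_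
  rintro ⟨x, hx⟩ ⟨y, hy⟩
  exact ((H x hx).trans (H y hy).symm).2.2

end ThreeConn

section Assembly

lemma Ssub_sub (t k : ℕ) : Ssub t k ⊆ Sset t := by
  unfold Ssub
  split
  · exact Set.diff_subset
  · exact Set.diff_subset
  · exact Set.diff_subset
  · exact subset_rfl

lemma Ssub_zero (t k : ℕ) : Sum.inl (0, 0) ∈ Ssub t k ∧ Sum.inl (0, 2) ∈ Ssub t k := by
  unfold Ssub
  split <;> simp [Sset]

lemma card_edges_G't (t : ℕ) : (G't t).edgeSet.ncard = 7 * (t + 1) + 3 := by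
  have h := handshake (G't t)
  rw [Fintype.sum_sum_type, Fintype.sum_bool, degG_u', degG_ne _ (by simp)] at h
  rw [Finset.sum_congr rfl (fun v _ => degG_ne (t := t) (Sum.inl v) (by simp))] at h
  simp at h
  omega

theorem brick_extremal (t k : ℕ) :
    IsBrick (expand (G't t) (Ssub t k)) ∧ IsExtremal (expand (G't t) (Ssub t k)) := by
  classical
  have hsub := Ssub_sub t k
  have hu' : Sum.inr true ∉ Ssub t k := fun h => by
    have := hsub h
    simp [Sset] at this
  have hd : ∀ v ∈ Ssub t k, ((G't t).neighborSet v).ncard = 3 :=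
    fun v hv => degG_ne v (fun h => hu' (h ▸ hv))
  refine ⟨⟨expand_threeConnected hd threeConnected_G't,
    fun x y hxy => expand_bicritical hd (bicF_G't t) x y hxy⟩, ?_⟩
  unfold _root_.IsExtremal
  rw [numPM_expand hd, card_expandVerts hd, card_expandEdges hd, card_edges_G't]
  let f : Fin 4 → ℕ → Bool := fun j s =>
    if h : s < t + 1 then decide (Sum.inl (⟨s, h⟩, j) ∈ Ssub t k) else false
  have hf : ∀ j (s : Fin (t + 1)), f j s = decide (Sum.inl (s, j) ∈ Ssub t k) :=
    fun j s => dif_pos s.2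
  have h0 : ∀ s : Fin (t + 1), Sum.inl (s, 0) ∈ Ssub t k ↔ ((s : ℕ) == 0) = true := by
    intro s
    constructor
    · intro h
      have := hsub h
      simp [Sset] at this
      simp [this]
    · intro h
      have : s = 0 := Fin.ext (by simpa using h)
      rw [this]; exact (Ssub_zero t k).1
  have h2 : ∀ s : Fin (t + 1), Sum.inl (s, 2) ∈ Ssub t k ↔ ((s : ℕ) == 0) = true := by
    intro s
    constructor
    · intro h
      have := hsub h
      simp [Sset] at this
      simp [this]
    · intro h
      have : s = 0 := Fin.ext (by simpa using h)
      rw [this]; exact (Ssub_zero t k).2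
  have hc := ncard_conf hu' (f 1) (f 3) (decide (Sum.inr false ∈ Ssub t k)) h0
    (fun s => by rw [hf]; simp) h2 (fun s => by rw [hf]; simp) (by simp)
  have hS : (Ssub t k).ncard = 2 + ∑ s ∈ Finset.range (t + 1), ((f 1 s).toNat + (f 3 s).toNat) +
      (decide (Sum.inr false ∈ Ssub t k)).toNat := by
    rw [← sum_ind, Fintype.sum_sum_type, Fintype.sum_prod_type, Fintype.sum_bool, if_neg hu']
    rw [← Fin.sum_univ_eq_sum_range (fun s => (f 1 s).toNat + (f 3 s).toNat) (t + 1)]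
    simp only [Fin.sum_univ_four, hf, h0, h2]
    have e1 : ∀ s : Fin (t + 1), ((if ((s : ℕ) == 0) = true then 1 else 0) +
        (if Sum.inl (s, 1) ∈ Ssub t k then 1 else 0) + (if ((s : ℕ) == 0) = true then 1 else 0) +
        (if Sum.inl (s, 3) ∈ Ssub t k then 1 else 0)) = (if s = 0 then 2 else 0) +
        ((decide (Sum.inl (s, 1) ∈ Ssub t k)).toNat +
          (decide (Sum.inl (s, 3) ∈ Ssub t k)).toNat) := by
      intro s
      have : ((s : ℕ) == 0) = true ↔ s = 0 := by simp
      simp only [this]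
      by_cases b : Sum.inl (s, 1) ∈ Ssub t k <;> by_cases c : Sum.inl (s, 3) ∈ Ssub t k <;>
        simp only [b, c, if_true, if_false, decide_true, decide_false, Bool.toNat_true,
          Bool.toNat_false] <;>
        split_ifs <;> rfl
    have e2 : ∑ s : Fin (t + 1), (if s = 0 then 2 else 0) = 2 := by simp
    rw [Finset.sum_congr rfl (fun s _ => e1 s), Finset.sum_add_distrib, e2]
    by_cases a : Sum.inr false ∈ Ssub t k <;> simp [a]
  rw [hc, ← hS]
  simp only [Fintype.card_sum, Fintype.card_prod, Fintype.card_fin, Fintype.card_bool]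
  omega

end Assembly

/-- For every even integer `n ≥ 18`, writing `n = i + 8(t+1)` with
`t ≥ 1` and `0 < i ≤ 8`, the graph `G''_n = G'_t⟨S_{i/2}⟩` is an extremal brick:
its number of perfect matchings equals `|E(G''_n)| − |V(G''_n)| + 1`. -/
theorem stmt8 (n t i : ℕ) (hne : Even n) (hn : 18 ≤ n) (ht : 1 ≤ t)
    (hi0 : 0 < i) (hi8 : i ≤ 8) (heq : n = i + 8 * (t + 1)) :
    IsBrick (expand (G't t) (Ssub t (i / 2))) ∧
      IsExtremal (expand (G't t) (Ssub t (i / 2))) := by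
  exact brick_extremal t (i / 2)
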